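/- Let G be an infinite locally finite connected graph such that (1) every block of G is either a cycle or a single edge (K₂), and (2) every vertex of G that is not contained in a cycle has all but at most two of its neighbors of degree 1. Then the line graph L(G) has a faithful spanning even semi-cactus. -/

import Mathlib

namespace IGraph

open SimpleGraph

universe u w

variable {V : Type u} {W : Type w}

/-- `G` is locally finite: every vertex has finite degree. -/
def LocFin (G : SimpleGraph V) : Prop := ∀ v : V, (G.neighborSet v).Finite

/-- A ray of `G`: a one-way infinite path, given by an injective sequence of
successively adjacent vertices. -/
def IsRay (G : SimpleGraph V) (R : ℕ → V) : Prop :=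
  Function.Injective R ∧ ∀ n : ℕ, G.Adj (R n) (R (n + 1))

/-- `G − S`, kept on the same vertex type (removed vertices become isolated). -/
def del (G : SimpleGraph V) (S : Set V) : SimpleGraph V where
  Adj a b := G.Adj a b ∧ a ∉ S ∧ b ∉ S
  symm := ⟨fun a b h => ⟨h.1.symm, h.2.2, h.2.1⟩⟩
  loopless := ⟨fun a h => G.loopless.irrefl a h.1⟩

/-- Two rays are equivalent in `G` if for every finite `S ⊆ V(G)` some component of
`G − S` contains a tail of both. -/
def RayEquiv (G : SimpleGraph V) (R₁ R₂ : ℕ → V) : Prop :=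
  ∀ S : Set V, S.Finite →
    ∃ m n : ℕ, (∀ i, m ≤ i → R₁ i ∉ S) ∧ (∀ j, n ≤ j → R₂ j ∉ S) ∧
      (del G S).Reachable (R₁ m) (R₂ n)

/-- `F` is a faithful subgraph of `G` (both presented on the same vertex type):
(1) every end of `G` contains a ray of `F`, and (2) two rays of `F` are equivalent in `F`
iff they are equivalent in `G`. -/
def Faithful (F G : SimpleGraph V) : Prop :=
  (∀ R : ℕ → V, IsRay G R → ∃ R' : ℕ → V, IsRay F R' ∧ RayEquiv G R R') ∧
  ∀ R₁ R₂ : ℕ → V, IsRay F R₁ → IsRay F R₂ → (RayEquiv F R₁ R₂ ↔ RayEquiv G R₁ R₂)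

/-- `N_G(X)`: vertices outside `X` with a neighbor in `X`. -/
def NSet (G : SimpleGraph V) (X : Set V) : Set V := {y | y ∉ X ∧ ∃ x ∈ X, G.Adj x y}

/-- `Z_G(X)`: vertices of `X` with a neighbor outside `X`. -/
def ZSet (G : SimpleGraph V) (X : Set V) : Set V := {x | x ∈ X ∧ ∃ y, y ∉ X ∧ G.Adj x y}

/-- The vertex set of the component of `G − S` containing `v`. -/
def compOf (G : SimpleGraph V) (S : Set V) (v : V) : Set V := {x | (del G S).Reachable v x}

/-- The degree of the end of `G` represented by the ray `R`: the supremum of the numbers of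
pairwise vertex-disjoint rays equivalent to `R`. -/
noncomputable def endDegree (G : SimpleGraph V) (R : ℕ → V) : ℕ∞ :=
  ⨆ n ∈ {n : ℕ | ∃ f : Fin n → ℕ → V,
      (∀ i, IsRay G (f i) ∧ RayEquiv G (f i) R) ∧
      ∀ i j, i ≠ j → Disjoint (Set.range (f i)) (Set.range (f j))}, (n : ℕ∞)

/-- `H` is `k`-connected: `|V(H)| > k` and removing fewer than `k` vertices leaves a
connected graph. -/
def IsKConn (k : ℕ) (H : SimpleGraph W) : Prop :=
  (k : Cardinal) < Cardinal.mk W ∧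
    ∀ X : Set W, X.Finite → X.ncard < k → (H.induce Xᶜ).Connected

/-- Every vertex has degree at most 3. -/
def Subcubic (G : SimpleGraph V) : Prop :=
  ∀ v : V, (G.neighborSet v).Finite ∧ (G.neighborSet v).ncard ≤ 3

/-- Every vertex has degree exactly 3. -/
def Cubic (G : SimpleGraph V) : Prop := ∀ v : V, (G.neighborSet v).ncard = 3

/-- `S` is 3-connected in `G`: every two vertices of `S` are joined by three pairwise
internally disjoint paths of `G`. -/
def ThreeConnIn (G : SimpleGraph V) (S : Set V) : Prop :=
  ∀ u v : V, u ∈ S → v ∈ S → u ≠ v →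
    ∃ p₁ p₂ p₃ : G.Path u v,
      p₁ ≠ p₂ ∧ p₁ ≠ p₃ ∧ p₂ ≠ p₃ ∧
      (∀ x, x ∈ (p₁ : G.Walk u v).support → x ∈ (p₂ : G.Walk u v).support → x = u ∨ x = v) ∧
      (∀ x, x ∈ (p₁ : G.Walk u v).support → x ∈ (p₃ : G.Walk u v).support → x = u ∨ x = v) ∧
      (∀ x, x ∈ (p₂ : G.Walk u v).support → x ∈ (p₃ : G.Walk u v).support → x = u ∨ x = v)

/-- A subgraph which is a (finite) cycle: finite, nonempty, connected and 2-regular. -/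
def IsCycleSub {G : SimpleGraph W} (C : G.Subgraph) : Prop :=
  C.verts.Finite ∧ C.verts.Nonempty ∧ C.Connected ∧
    ∀ v ∈ C.verts, (C.neighborSet v).ncard = 2

/-- A cactus: a connected subcubic graph whose cycles are pairwise vertex-disjoint and whose
edges decompose into vertex-disjoint cycles and vertex-disjoint paths (equivalently, every
vertex on no cycle has degree at most 2). -/
def IsCactus (H : SimpleGraph W) : Prop :=
  H.Connected ∧ Subcubic H ∧
  (∀ C₁ C₂ : H.Subgraph, IsCycleSub C₁ → IsCycleSub C₂ → C₁ ≠ C₂ →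
    Disjoint C₁.verts C₂.verts) ∧
  ∀ v : W, (∀ C : H.Subgraph, IsCycleSub C → v ∉ C.verts) → (H.neighborSet v).ncard ≤ 2

/-- A semi-cactus: connected, maximum degree at most 4, every block is a cycle or a `K₂`
(equivalently, distinct cycles are edge-disjoint), and every vertex lies in at most two
blocks (cycles through `v` together with bridges at `v` number at most 2). -/
def IsSemiCactus (H : SimpleGraph W) : Prop :=
  H.Connected ∧ (∀ v : W, (H.neighborSet v).Finite ∧ (H.neighborSet v).ncard ≤ 4) ∧
  (∀ C₁ C₂ : H.Subgraph, IsCycleSub C₁ → IsCycleSub C₂ → C₁ ≠ C₂ →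
    Disjoint C₁.edgeSet C₂.edgeSet) ∧
  ∀ v : W,
    {C : H.Subgraph | IsCycleSub C ∧ v ∈ C.verts}.encard +
      {e : Sym2 W | e ∈ H.edgeSet ∧ v ∈ e ∧
        ∀ C : H.Subgraph, IsCycleSub C → e ∉ C.edgeSet}.encard ≤ 2

/-- Every cycle of `H` is even. -/
def EvenCycles (H : SimpleGraph W) : Prop :=
  ∀ C : H.Subgraph, IsCycleSub C → Even C.verts.ncard

/-- `v` is a cut-vertex of `H`: removing `v` separates two vertices. -/
def IsCutVert (H : SimpleGraph W) (v : W) : Prop :=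
  ∃ a b : W, a ≠ v ∧ b ≠ v ∧ H.Reachable a b ∧ ¬ (del H {v}).Reachable a b

/-- `H` is non-separable: connected without cut-vertices. -/
def Nonseparable (H : SimpleGraph W) : Prop := H.Connected ∧ ∀ v : W, ¬ IsCutVert H v

/-- `B` is the vertex set of a block of `H`: a maximal set inducing a non-separable graph. -/
def IsBlockSet (H : SimpleGraph W) (B : Set W) : Prop :=
  Nonseparable (H.induce B) ∧ ∀ B' : Set W, B ⊆ B' → Nonseparable (H.induce B') → B' = B

/-- An end-block: a block containing at most one cut-vertex of `H`. -/
def IsEndBlock (H : SimpleGraph W) (B : Set W) : Prop :=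
  IsBlockSet H B ∧ {v ∈ B | IsCutVert H v}.encard ≤ 1

/-- A block-chain: a connected graph whose block-cut tree is a path, i.e. every block
contains at most two cut-vertices and every cut-vertex lies in at most two blocks. -/
def IsBlockChain (H : SimpleGraph W) : Prop :=
  H.Connected ∧
  (∀ B : Set W, IsBlockSet H B → {v ∈ B | IsCutVert H v}.encard ≤ 2) ∧
  ∀ v : W, IsCutVert H v → {B : Set W | IsBlockSet H B ∧ v ∈ B}.encard ≤ 2

/-- A block-chain connecting `u` and `v`: either `H` is non-separable, or `H` is separable
and `u`, `v` are non-cut vertices of two distinct end-blocks. -/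
def BlockChainConn (H : SimpleGraph W) (u v : W) : Prop :=
  IsBlockChain H ∧
  (Nonseparable H ∨
    ((∃ x, IsCutVert H x) ∧
      ∃ B₁ B₂ : Set W, IsEndBlock H B₁ ∧ IsEndBlock H B₂ ∧ B₁ ≠ B₂ ∧
        u ∈ B₁ ∧ v ∈ B₂ ∧ ¬ IsCutVert H u ∧ ¬ IsCutVert H v))

/-- The `k`-th power of `G`: vertices at distance at most `k` become adjacent. -/
def gpow (G : SimpleGraph V) (k : ℕ) : SimpleGraph V where
  Adj u v := u ≠ v ∧ ∃ p : G.Walk u v, p.length ≤ k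
  symm := ⟨fun u v h => ⟨h.1.symm, by obtain ⟨p, hp⟩ := h.2; exact ⟨p.reverse, by simpa using hp⟩⟩⟩
  loopless := ⟨fun v h => h.1 rfl⟩

/-- The copy `G × {d₀}` of `G` inside the Cartesian product `G □ D`. -/
def copyAt (G : SimpleGraph V) (d₀ : W) : SimpleGraph (V × W) where
  Adj p q := G.Adj p.1 q.1 ∧ p.2 = d₀ ∧ q.2 = d₀
  symm := ⟨fun p q h => ⟨h.1.symm, h.2.2, h.2.1⟩⟩
  loopless := ⟨fun p h => G.loopless.irrefl _ h.1⟩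

/-- The line graph of the subgraph `F` of `G`, presented on the vertex set `E(G)` of the
line graph of `G` (edges of `G` not in `F` are isolated). -/
def lineSub (G F : SimpleGraph V) : SimpleGraph G.edgeSet where
  Adj e f := (e : Sym2 V) ∈ F.edgeSet ∧ (f : Sym2 V) ∈ F.edgeSet ∧ e ≠ f ∧
    ∃ x : V, x ∈ (e : Sym2 V) ∧ x ∈ (f : Sym2 V)
  symm := ⟨fun e f h =>
    ⟨h.2.1, h.1, h.2.2.1.symm, by obtain ⟨x, h1, h2⟩ := h.2.2.2; exact ⟨x, h2, h1⟩⟩⟩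
  loopless := ⟨fun e h => h.2.2.1 rfl⟩

/-- `B ⊆ V(G)` induces a cycle of `G`. -/
def IsCycleSet (G : SimpleGraph V) (B : Set V) : Prop :=
  B.Finite ∧ B.Nonempty ∧ (G.induce B).Connected ∧
    ∀ v ∈ B, (G.neighborSet v ∩ B).ncard = 2

/-! ### Reachability -/

/-- A property preserved by adjacency is preserved by reachability. -/
theorem reachable_induction {H : SimpleGraph W} {p : W → Prop} {a b : W} (h : H.Reachable a b)
    (ha : p a) (hstep : ∀ x y, p x → H.Adj x y → p y) : p b := by
  rw [reachable_iff_reflTransGen] at h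
  induction h with
  | refl => exact ha
  | tail _ hxy ih => exact hstep _ _ ih hxy

/-- If adjacent vertices of `H` are reachable from each other in `K`, then so are vertices
reachable from each other in `H`. -/
theorem reachable_of_forall_adj {H K : SimpleGraph W} {a b : W} (h : H.Reachable a b)
    (hstep : ∀ x y, H.Adj x y → K.Reachable x y) : K.Reachable a b :=
  reachable_induction (p := fun z => K.Reachable a z) h (Reachable.refl a)
    fun x y hx hxy => hx.trans (hstep x y hxy)

theorem del_anti {H : SimpleGraph W} {S T : Set W} (h : S ⊆ T) : del H T ≤ del H S :=
  fun _ _ hab => ⟨hab.1, fun ha => hab.2.1 (h ha), fun hb => hab.2.2 (h hb)⟩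

theorem del_mono {H K : SimpleGraph W} (h : H ≤ K) (S : Set W) : del H S ≤ del K S :=
  fun _ _ hab => ⟨h hab.1, hab.2⟩

theorem reachable_del_of_walk {H : SimpleGraph W} {S : Set W} {a b : W} (p : H.Walk a b)
    (hp : ∀ x ∈ p.support, x ∉ S) : (del H S).Reachable a b := by
  induction p with
  | nil => exact Reachable.refl _
  | cons hadj q ih =>
    refine Reachable.trans (Adj.reachable ⟨hadj, hp _ (by simp), hp _ (by simp)⟩)
      (ih fun x hx => hp x (by simp [hx]))

/-! ### Parity -/

/-- If all vertices of a finite set `X` have degree two and all edges leaving `X` end in `v`,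
then the number of these edges is even. -/
theorem even_ncard_leaving {H : SimpleGraph W} {X : Set W} (hX : X.Finite) {v : W} (hv : v ∉ X)
    (hdeg : ∀ x ∈ X, (H.neighborSet x).ncard = 2)
    (hout : ∀ x ∈ X, ∀ y, H.Adj x y → y ∉ X → y = v) :
    Even {x | x ∈ X ∧ H.Adj x v}.ncard := by
  classical
  have : Fintype X := hX.fintype
  have key := (H.induce X).even_card_odd_degree_vertices
  have hodd : ∀ x : X, Odd ((H.induce X).degree x) ↔ H.Adj x v := by
    intro x
    have hfin : (H.neighborSet x).Finite :=
      Set.finite_of_ncard_ne_zero (by rw [hdeg x x.2]; norm_num)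
    have h1 : (H.induce X).degree x = (H.neighborSet x ∩ X).ncard := by
      rw [← card_neighborSet_eq_degree, ← Nat.card_eq_fintype_card, Nat.card_coe_set_eq,
        ← Set.ncard_image_of_injective _ Subtype.val_injective]
      congr 1
      ext y
      simp only [Set.mem_image, mem_neighborSet, comap_adj, Function.Embedding.subtype_apply,
        Set.mem_inter_iff, Subtype.exists, exists_and_left, exists_prop, exists_eq_right_right]
    rw [h1]
    by_cases hxv : H.Adj x v
    · have h2 : H.neighborSet x ∩ X = H.neighborSet x \ {v} := by
        ext y
        simp only [Set.mem_inter_iff, mem_neighborSet, Set.mem_sdiff, Set.mem_singleton_iff]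
        constructor
        · rintro ⟨ha, hb⟩
          exact ⟨ha, fun h => hv (h ▸ hb)⟩
        · rintro ⟨ha, hb⟩
          exact ⟨ha, by_contra fun h => hb (hout x x.2 y ha h)⟩
      have h3 : (H.neighborSet x \ {v}).ncard = 1 := by
        rw [Set.ncard_sdiff_singleton_of_mem (by exact hxv), hdeg x x.2]
      rw [h2, h3]
      simp [hxv]
    · have h2 : H.neighborSet x ∩ X = H.neighborSet x := by
        ext y
        simp only [Set.mem_inter_iff, mem_neighborSet, and_iff_left_iff_imp]
        intro ha
        by_contra h
        exact hxv (hout x x.2 y ha h ▸ ha)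
      rw [h2, hdeg x x.2]
      simp [hxv]
  have hset : {x | x ∈ X ∧ H.Adj x v} =
      Subtype.val '' ((Finset.univ.filter fun x : X => Odd ((H.induce X).degree x)) : Set X) := by
    ext y
    simp [hodd, and_comm]
  rw [hset, Set.ncard_image_of_injective _ Subtype.val_injective, Set.ncard_coe_finset]
  exact key

/-- In the situation of `even_ncard_leaving`, if `v` has degree two and some neighbor in `X`,
then all its neighbors are in `X`. -/
theorem neighbors_mem_of_leaving {H : SimpleGraph W} {X : Set W} (hX : X.Finite) {v : W}
    (hv : v ∉ X) (hdeg : ∀ x ∈ X, (H.neighborSet x).ncard = 2)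
    (hout : ∀ x ∈ X, ∀ y, H.Adj x y → y ∉ X → y = v) (hdv : (H.neighborSet v).ncard = 2)
    {a : W} (ha : a ∈ X) (hva : H.Adj v a) {b : W} (hvb : H.Adj v b) : b ∈ X := by
  have hev := even_ncard_leaving hX hv hdeg hout
  by_contra hb
  have hset : {x | x ∈ X ∧ H.Adj x v} = {a} := by
    obtain ⟨c, d, hcd, hN⟩ := Set.ncard_eq_two.1 hdv
    ext x
    have h1 : a ∈ H.neighborSet v := hva
    have h2 : b ∈ H.neighborSet v := hvb
    have h3 : H.Adj x v ↔ x ∈ H.neighborSet v := by simp [H.adj_comm]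
    simp only [Set.mem_ofPred_eq, h3, Set.mem_singleton_iff]
    rw [hN] at h1 h2 ⊢
    simp only [Set.mem_insert_iff, Set.mem_singleton_iff] at h1 h2 ⊢
    grind
  rw [hset] at hev
  simp at hev

/-! ### Cycles as graphs -/

/-- `C` is a cycle, together with isolated vertices. -/
structure IsCyc (C : SimpleGraph W) : Prop where
  finite : C.support.Finite
  nonempty : C.support.Nonempty
  conn : ∀ a ∈ C.support, ∀ b ∈ C.support, C.Reachable a b
  deg : ∀ v ∈ C.support, (C.neighborSet v).ncard = 2

theorem IsCycleSub.support_eq {H : SimpleGraph W} {C : H.Subgraph} (hC : IsCycleSub C) :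
    C.spanningCoe.support = C.verts := by
  ext v
  constructor
  · rintro ⟨w, hw⟩
    exact C.edge_vert hw
  · intro hv
    have h2 := hC.2.2.2 v hv
    obtain ⟨w, hw⟩ := Set.nonempty_of_ncard_ne_zero (s := C.neighborSet v) (by omega)
    exact ⟨w, hw⟩

theorem IsCycleSub.isCyc {H : SimpleGraph W} {C : H.Subgraph} (hC : IsCycleSub C) :
    IsCyc C.spanningCoe where
  finite := by rw [hC.support_eq]; exact hC.1
  nonempty := by rw [hC.support_eq]; exact hC.2.1
  conn a ha b hb := by
    rw [hC.support_eq] at ha hb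
    have h := hC.2.2.1.coe.preconnected ⟨a, ha⟩ ⟨b, hb⟩
    exact h.map (⟨Subtype.val, fun h => h⟩ : C.coe →g C.spanningCoe)
  deg v hv := by
    rw [hC.support_eq] at hv
    exact hC.2.2.2 v hv

theorem IsCycleSub.ext_spanningCoe {H : SimpleGraph W} {C C' : H.Subgraph} (hC : IsCycleSub C)
    (hC' : IsCycleSub C') (h : C.spanningCoe = C'.spanningCoe) : C = C' := by
  refine Subgraph.ext ?_ (Subgraph.spanningCoe_inj.1 h)
  rw [← hC.support_eq, ← hC'.support_eq, h]

theorem IsCyc.finite_neighborSet {C : SimpleGraph W} (hC : IsCyc C) {v : W}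
    (hv : v ∈ C.support) : (C.neighborSet v).Finite :=
  Set.finite_of_ncard_ne_zero (by rw [hC.deg v hv]; norm_num)

/-- A set which contains a vertex of a cycle and is closed under adjacency contains the cycle. -/
theorem IsCyc.subset_of_closed {C : SimpleGraph W} (hC : IsCyc C) {X : Set W} {a : W}
    (ha : a ∈ C.support) (haX : a ∈ X) (hX : ∀ x ∈ X, ∀ y, C.Adj x y → y ∈ X) :
    C.support ⊆ X := fun b hb =>
  reachable_induction (hC.conn a ha b hb) haX fun x y hx hxy => hX x hx y hxy

theorem IsCyc.eq_of_le {C Z : SimpleGraph W} (hC : IsCyc C) (hZ : IsCyc Z) (h : C ≤ Z) :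
    C = Z := by
  have hN : ∀ v ∈ C.support, C.neighborSet v = Z.neighborSet v := fun v hv =>
    Set.eq_of_subset_of_ncard_le (fun x hx => h hx)
      (by rw [hC.deg v hv, hZ.deg v (support_mono h hv)])
      (hZ.finite_neighborSet (support_mono h hv))
  obtain ⟨a, ha⟩ := hC.nonempty
  have hsub : Z.support ⊆ C.support := by
    refine hZ.subset_of_closed (support_mono h ha) ha fun x hx y hxy => ?_
    have : y ∈ C.neighborSet x := by rw [hN x hx]; exact hxy
    exact Adj.mem_support_right this
  refine le_antisymm h fun x y hxy => ?_
  have hx := hsub (Adj.mem_support_left hxy)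
  have : y ∈ C.neighborSet x := by rw [hN x hx]; exact hxy
  exact this

/-- A vertex with at most one neighbor is on no cycle. -/
theorem IsCyc.notMem_support {C D : SimpleGraph W} (hC : IsCyc C) (h : C ≤ D) {x c : W}
    (hx : ∀ y, D.Adj x y → y = c) : x ∉ C.support := by
  intro hxC
  have hle : (C.neighborSet x).ncard ≤ ({c} : Set W).ncard :=
    Set.ncard_le_ncard (fun y hy => hx y (h hy)) (Set.finite_singleton c)
  rw [hC.deg x hxC, Set.ncard_singleton] at hle
  omega

/-- The neighbors of a vertex of a cycle are connected in the cycle minus the vertex. -/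
theorem IsCyc.reachable_del {C : SimpleGraph W} (hC : IsCyc C) {v a b : W} (ha : C.Adj v a)
    (hb : C.Adj v b) : (del C {v}).Reachable a b := by
  set X : Set W := {x | x ∈ C.support ∧ x ≠ v ∧ (del C {v}).Reachable a x} with hXdef
  have hbX : b ∈ X := by
    refine neighbors_mem_of_leaving (H := C) (X := X) (v := v)
      (hC.finite.subset fun x hx => hx.1) (fun h => h.2.1 rfl) (fun x hx => hC.deg x hx.1) ?_
      (hC.deg v ha.mem_support_left) (a := a) ⟨ha.mem_support_right, ha.ne', Reachable.refl _⟩ ha hb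
    intro x hx y hxy hy
    by_contra hyv
    exact hy ⟨hxy.mem_support_right, hyv, hx.2.2.trans (Adj.reachable ⟨hxy, hx.2.1, hyv⟩)⟩
  exact hbX.2.2

/-! ### Surgery on cycles and paths -/

/-- Subdivide the edge `ab` of `Z` by the vertex `x`. -/
def subdivide (Z : SimpleGraph W) (a b x : W) : SimpleGraph W :=
  Z.deleteEdges {s(a, b)} ⊔ (edge a x ⊔ edge x b)

theorem subdivide_adj {Z : SimpleGraph W} {a b x : W} (hxa : x ≠ a) (hxb : x ≠ b) (p q : W) :
    (subdivide Z a b x).Adj p q ↔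
      (Z.Adj p q ∧ ¬ (p = a ∧ q = b) ∧ ¬ (p = b ∧ q = a)) ∨
        (p = x ∧ (q = a ∨ q = b)) ∨ (q = x ∧ (p = a ∨ p = b)) := by
  simp only [subdivide, sup_adj, deleteEdges_adj, edge_adj, Set.mem_singleton_iff, Sym2.eq_iff]
  grind

theorem support_subdivide {Z : SimpleGraph W} {a b x : W} (hab : Z.Adj a b)
    (hx : x ∉ Z.support) : (subdivide Z a b x).support = insert x Z.support := by
  have hxa : x ≠ a := fun h => hx (h ▸ hab.mem_support_left)
  have hxb : x ≠ b := fun h => hx (h ▸ hab.mem_support_right)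
  ext p
  simp only [mem_support, Set.mem_insert_iff, subdivide_adj hxa hxb]
  constructor
  · rintro ⟨q, ⟨h, -⟩ | ⟨h, -⟩ | ⟨-, rfl | rfl⟩⟩
    · exact Or.inr ⟨q, h⟩
    · exact Or.inl h
    · exact Or.inr ⟨b, hab⟩
    · exact Or.inr ⟨a, hab.symm⟩
  · rintro (rfl | ⟨q, h⟩)
    · exact ⟨a, by simp⟩
    · by_cases hp : p = a ∨ p = b
      · exact ⟨x, Or.inr (Or.inr ⟨rfl, hp⟩)⟩
      · exact ⟨q, Or.inl ⟨h, by tauto, by tauto⟩⟩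

theorem IsCyc.subdivide {Z : SimpleGraph W} (hZ : IsCyc Z) {a b x : W} (hab : Z.Adj a b)
    (hx : x ∉ Z.support) : IsCyc (subdivide Z a b x) := by
  have hxa : x ≠ a := fun h => hx (h ▸ hab.mem_support_left)
  have hxb : x ≠ b := fun h => hx (h ▸ hab.mem_support_right)
  have hxZ : ∀ y, ¬ Z.Adj x y := fun y h => hx h.mem_support_left
  have hadj := subdivide_adj (Z := Z) hxa hxb
  have hreach : ∀ p q, Z.Adj p q → (IGraph.subdivide Z a b x).Reachable p q := by
    have h1 : (IGraph.subdivide Z a b x).Adj a x := by rw [hadj]; simp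
    have h2 : (IGraph.subdivide Z a b x).Adj x b := by rw [hadj]; simp
    intro p q hpq
    by_cases hp : p = a ∧ q = b
    · rw [hp.1, hp.2]
      exact h1.reachable.trans h2.reachable
    by_cases hq : p = b ∧ q = a
    · rw [hq.1, hq.2]
      exact (h1.reachable.trans h2.reachable).symm
    exact Adj.reachable ((hadj p q).2 (Or.inl ⟨hpq, hp, hq⟩))
  have hne : a ≠ b := hab.ne
  refine ⟨?_, ?_, ?_, ?_⟩
  · rw [support_subdivide hab hx]
    exact hZ.finite.insert x
  · rw [support_subdivide hab hx]
    exact Set.insert_nonempty _ _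
  · have key : ∀ p ∈ (IGraph.subdivide Z a b x).support,
        (IGraph.subdivide Z a b x).Reachable a p := by
      intro p hp
      rw [support_subdivide hab hx] at hp
      rcases hp with rfl | hp
      · exact Adj.reachable ((hadj _ _).2 (by simp))
      · exact reachable_of_forall_adj (hZ.conn a hab.mem_support_left p hp) hreach
    intro p hp q hq
    exact (key p hp).symm.trans (key q hq)
  · intro p hp
    rw [support_subdivide hab hx] at hp
    by_cases hpx : p = x
    · rw [Set.ncard_eq_two]
      refine ⟨a, b, hne, ?_⟩
      ext q
      simp only [mem_neighborSet, hadj, Set.mem_insert_iff, Set.mem_singleton_iff]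
      have := hxZ q
      grind
    · have hpZ : p ∈ Z.support := hp.resolve_left hpx
      have hd := hZ.deg p hpZ
      have hfin := hZ.finite_neighborSet hpZ
      have hswap : ∀ c, Z.Adj p c → ({x} ∪ (Z.neighborSet p \ {c})).ncard = 2 := by
        intro c hc
        rw [Set.singleton_union, Set.ncard_insert_of_notMem
          (fun h => hx (Adj.mem_support_right h.1)) hfin.sdiff,
          Set.ncard_sdiff_singleton_of_mem (by exact hc), hd]
      by_cases hpa : p = a
      · rw [← hswap b (hpa ▸ hab)]
        congr 1
        ext q
        simp only [mem_neighborSet, hadj, Set.mem_union, Set.mem_singleton_iff, Set.mem_sdiff]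
        grind
      by_cases hpb : p = b
      · rw [← hswap a (hpb ▸ hab.symm)]
        congr 1
        ext q
        simp only [mem_neighborSet, hadj, Set.mem_union, Set.mem_singleton_iff, Set.mem_sdiff]
        grind
      · rw [← hd]
        congr 1
        ext q
        simp only [mem_neighborSet, hadj]
        grind

/-- Deleting an edge from a cycle does not disconnect it. -/
theorem IsCyc.reachable_deleteEdges {Z : SimpleGraph W} (hZ : IsCyc Z) {a b p q : W}
    (hab : Z.Adj a b) (hp : p ∈ Z.support) (hq : q ∈ Z.support) :
    (Z.deleteEdges {s(a, b)}).Reachable p q := by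
  have hbr : (Z.deleteEdges {s(a, b)}).Reachable a b := by
    obtain ⟨c, d, hcd, hN⟩ := Set.ncard_eq_two.1 (hZ.deg a hab.mem_support_left)
    have hb : b ∈ Z.neighborSet a := hab
    obtain ⟨c', hc', hcb⟩ : ∃ c', Z.Adj a c' ∧ c' ≠ b := by
      have h1 : c ∈ Z.neighborSet a := by rw [hN]; simp
      have h2 : d ∈ Z.neighborSet a := by rw [hN]; simp
      by_cases h : c = b
      · exact ⟨d, h2, fun h' => hcd (h.trans h'.symm)⟩
      · exact ⟨c, h1, h⟩
    have h1 : (Z.deleteEdges {s(a, b)}).Adj a c' := by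
      simp only [deleteEdges_adj, Set.mem_singleton_iff, Sym2.eq_iff]
      exact ⟨hc', by have := hc'.ne; grind⟩
    refine h1.reachable.trans (reachable_of_forall_adj (hZ.reachable_del hc' hab) ?_)
    rintro x y ⟨hxy, hx, hy⟩
    refine Adj.reachable ?_
    simp only [deleteEdges_adj, Set.mem_singleton_iff, Sym2.eq_iff] at hx hy ⊢
    exact ⟨hxy, by grind⟩
  refine reachable_of_forall_adj (hZ.conn p hp q hq) fun x y hxy => ?_
  by_cases h : s(x, y) = s(a, b)
  · rw [Sym2.eq_iff] at h
    rcases h with ⟨rfl, rfl⟩ | ⟨rfl, rfl⟩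
    · exact hbr
    · exact hbr.symm
  · exact Adj.reachable (by simp only [deleteEdges_adj, Set.mem_singleton_iff]; exact ⟨hxy, h⟩)

/-! ### Cells -/

/-- `D` is a connected graph on `X` with at most one cycle, namely `Z`, which is even, and every
vertex `e ∈ X` lies in at most `w e` blocks of `D`. -/
structure CellSpec (L : SimpleGraph W) (X : Set W) (w : W → ℕ) (D Z : SimpleGraph W) : Prop where
  le : D ≤ L
  mem : ∀ a b, D.Adj a b → a ∈ X
  conn : ∀ a ∈ X, ∀ b ∈ X, D.Reachable a b
  cycle_le : Z ≤ D
  cycle : Z = ⊥ ∨ IsCyc Z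
  even : Even Z.support.ncard
  uniq : ∀ C, IsCyc C → C ≤ D → C = Z
  count : ∀ e ∈ X, {C | C = Z ∧ e ∈ Z.support}.encard +
    {f | D.Adj e f ∧ ¬ Z.Adj e f}.encard ≤ w e

theorem encard_eq_and_le_one {α : Type*} (z : α) (p : Prop) : {c | c = z ∧ p}.encard ≤ 1 :=
  (Set.encard_le_encard (t := {z}) fun _ hc => hc.1).trans (Set.encard_singleton z).le

/-- An even cycle is a cell. -/
theorem CellSpec.of_cyc {L Z : SimpleGraph W} {w : W → ℕ} (hZ : IsCyc Z) (hle : Z ≤ L)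
    (heven : Even Z.support.ncard) (hw : ∀ e ∈ Z.support, 1 ≤ w e) :
    CellSpec L Z.support w Z Z where
  le := hle
  mem _ _ h := h.mem_support_left
  conn := hZ.conn
  cycle_le := le_rfl
  cycle := Or.inr hZ
  even := heven
  uniq _ hC h := hC.eq_of_le hZ h
  count e he := by
    have : {f | Z.Adj e f ∧ ¬ Z.Adj e f} = ∅ := by ext; simp
    rw [this, Set.encard_empty, add_zero]
    exact (encard_eq_and_le_one _ _).trans (by exact_mod_cast hw e he)

theorem sup_edge_adj {D : SimpleGraph W} {x c : W} (hxc : x ≠ c) (p q : W) :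
    (D ⊔ edge x c).Adj p q ↔ D.Adj p q ∨ (p = x ∧ q = c) ∨ (p = c ∧ q = x) := by
  simp only [sup_adj, edge_adj]
  grind

/-- A cycle in a graph with a pendant edge avoids this edge. -/
theorem IsCyc.le_of_le_sup_edge {C D : SimpleGraph W} (hC : IsCyc C) {x c : W} (hxc : x ≠ c)
    (hx : x ∉ D.support) (h : C ≤ D ⊔ edge x c) : C ≤ D := by
  have hxC : x ∉ C.support := hC.notMem_support h (c := c) fun y hy => by
    rw [sup_edge_adj hxc] at hy
    rcases hy with hy | hy | hy
    · exact absurd hy.mem_support_left hx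
    · exact hy.2
    · exact absurd hy.1 hxc
  intro p q hpq
  rcases (sup_edge_adj hxc p q).1 (h hpq) with hy | hy | hy
  · exact hy
  · exact absurd (hy.1 ▸ hpq.mem_support_left) hxC
  · exact absurd (hy.2 ▸ hpq.mem_support_right) hxC

/-- An even cycle with a pendant edge `xc` attached to it is a cell. -/
theorem CellSpec.of_cyc_pendant {L Z : SimpleGraph W} {w : W → ℕ} (hZ : IsCyc Z) (hle : Z ≤ L)
    (heven : Even Z.support.ncard) {x c : W} (hx : x ∉ Z.support) (hc : c ∈ Z.support)
    (hxc : L.Adj x c) (hw : ∀ e ∈ insert x Z.support, 1 ≤ w e) (hwc : 2 ≤ w c) :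
    CellSpec L (insert x Z.support) w (Z ⊔ edge x c) Z where
  le := sup_le hle (by
    intro p q hpq
    simp only [edge_adj] at hpq
    rcases hpq.1 with h | h
    · rw [h.1, h.2]; exact hxc
    · rw [h.1, h.2]; exact hxc.symm)
  mem a b h := by
    rw [sup_edge_adj hxc.ne] at h
    rcases h with h | h | h
    · exact Or.inr h.mem_support_left
    · exact Or.inl h.1
    · exact Or.inr (h.1 ▸ hc)
  conn := by
    have key : ∀ a ∈ insert x Z.support, (Z ⊔ edge x c).Reachable c a := by
      rintro a (rfl | ha)
      · exact Adj.reachable ((sup_edge_adj hxc.ne _ _).2 (by simp))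
      · exact (hZ.conn c hc a ha).mono le_sup_left
    exact fun a ha b hb => (key a ha).symm.trans (key b hb)
  cycle_le := le_sup_left
  cycle := Or.inr hZ
  even := heven
  uniq C hC h := hC.eq_of_le hZ (hC.le_of_le_sup_edge hxc.ne hx h)
  count e he := by
    by_cases hex : e = x
    · have h1 : {C | C = Z ∧ e ∈ Z.support} = ∅ := by
        ext C; simpa [hex] using fun _ => hx
      rw [h1, Set.encard_empty, zero_add]
      refine (Set.encard_le_encard (t := {c}) ?_).trans
        ((Set.encard_singleton c).le.trans (by exact_mod_cast hw e he))
      rintro f ⟨hf, hf'⟩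
      rw [sup_edge_adj hxc.ne] at hf
      have := hxc.ne
      simp only [Set.mem_singleton_iff]
      grind
    by_cases hec : e = c
    · refine le_trans (add_le_add (encard_eq_and_le_one _ _) ?_) (b := 1 + 1) ?_
      · refine (Set.encard_le_encard (t := {x}) ?_).trans (Set.encard_singleton x).le
        rintro f ⟨hf, hf'⟩
        rw [sup_edge_adj hxc.ne] at hf
        simp only [Set.mem_singleton_iff]
        grind
      · rw [one_add_one_eq_two, hec]
        exact_mod_cast hwc
    · have h2 : {f | (Z ⊔ edge x c).Adj e f ∧ ¬ Z.Adj e f} = ∅ := by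
        ext f
        simp only [sup_edge_adj hxc.ne, Set.mem_ofPred_eq, Set.mem_empty_iff_false, iff_false]
        grind
      rw [h2, Set.encard_empty, add_zero]
      exact (encard_eq_and_le_one _ _).trans (by exact_mod_cast hw e he)

/-- A connected graph without cycles in which every vertex has small degree is a cell. -/
theorem CellSpec.of_acyclic {L D : SimpleGraph W} {X : Set W} {w : W → ℕ} (hle : D ≤ L)
    (hmem : ∀ a b, D.Adj a b → a ∈ X) (hconn : ∀ a ∈ X, ∀ b ∈ X, D.Reachable a b)
    (hcyc : ∀ C, IsCyc C → ¬ C ≤ D) (hw : ∀ e ∈ X, (D.neighborSet e).encard ≤ w e) :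
    CellSpec L X w D ⊥ where
  le := hle
  mem := hmem
  conn := hconn
  cycle_le := bot_le
  cycle := Or.inl rfl
  even := by simp
  uniq C hC h := absurd h (hcyc C hC)
  count e he := by
    have h1 : {C : SimpleGraph W | C = ⊥ ∧ e ∈ (⊥ : SimpleGraph W).support} = ∅ := by
      ext C; simp
    rw [h1, Set.encard_empty, zero_add]
    refine le_trans (Set.encard_le_encard ?_) (hw e he)
    rintro f ⟨hf, -⟩
    exact hf

/-- A cycle minus an edge `fg` is a cell. -/
theorem CellSpec.of_cyc_deleteEdges {L Z : SimpleGraph W} {w : W → ℕ} (hZ : IsCyc Z)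
    (hle : Z ≤ L) {f g : W} (hfg : Z.Adj f g) (hwf : 1 ≤ w f)
    (hw : ∀ e ∈ Z.support, e ≠ f → 2 ≤ w e) :
    CellSpec L Z.support w (Z.deleteEdges {s(f, g)}) ⊥ := by
  refine CellSpec.of_acyclic ((deleteEdges_le _).trans hle)
    (fun a b h => (deleteEdges_le _ h).mem_support_left)
    (fun a ha b hb => hZ.reachable_deleteEdges hfg ha hb) ?_ ?_
  · intro C hC h
    have := hC.eq_of_le hZ (h.trans (deleteEdges_le _))
    rw [this] at h
    have := h hfg
    simp [deleteEdges_adj] at this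
  · intro e he
    have hfin := hZ.finite_neighborSet he
    have hcard : (Z.neighborSet e).encard = 2 := by
      rw [← hfin.cast_ncard_eq, hZ.deg e he]; rfl
    by_cases hef : e = f
    · have hsub : (Z.deleteEdges {s(f, g)}).neighborSet e ⊆ Z.neighborSet e \ {g} := by
        intro y hy
        simp only [mem_neighborSet, deleteEdges_adj, Set.mem_singleton_iff] at hy
        refine ⟨hy.1, fun hyg => hy.2 ?_⟩
        rw [hef, Set.mem_singleton_iff.1 hyg]
      refine (Set.encard_le_encard hsub).trans ?_
      have h1 : (Z.neighborSet e \ {g}).ncard = 1 := by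
        rw [Set.ncard_sdiff_singleton_of_mem (by rw [hef]; exact hfg), hZ.deg e he]
      rw [← hfin.sdiff.cast_ncard_eq, h1, hef]
      exact_mod_cast hwf
    · refine (Set.encard_le_encard fun y hy => deleteEdges_le _ hy).trans
        (hcard.le.trans ?_)
      exact_mod_cast hw e he hef

/-- A finite set of at least two vertices is the vertex set of a path with prescribed
distinct ends `q` and `p`. -/
theorem exists_path {q : W} (Y : Finset W) : q ∉ Y → ∀ p, p ∉ Y → p ≠ q →
    ∃ D : SimpleGraph W, D.support ⊆ insert p (insert q (Y : Set W)) ∧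
    (∀ a ∈ insert p (insert q (Y : Set W)), D.Reachable q a) ∧ (∀ C, IsCyc C → ¬ C ≤ D) ∧
    (∀ e, (D.neighborSet e).encard ≤ 2) ∧ (D.neighborSet p).encard ≤ 1 ∧
    (D.neighborSet q).encard ≤ 1 := by
  classical
  induction Y using Finset.induction_on with
  | empty =>
    intro _ p _ hpq
    have hN : ∀ x y, (edge p q).Adj x y → y = if x = p then q else p := by
      intro x y h
      rw [edge_adj] at h
      grind
    have hcard : ∀ x, ((edge p q).neighborSet x).encard ≤ 1 := fun x =>
      (Set.encard_le_encard (t := {if x = p then q else p}) fun y hy => hN x y hy).trans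
        (Set.encard_singleton _).le
    refine ⟨edge p q, ?_, ?_, ?_, fun e => (hcard e).trans (by norm_num), hcard p, hcard q⟩
    · intro x hx
      obtain ⟨y, hxy⟩ := hx
      have hxy : (edge p q).Adj x y := hxy
      rw [edge_adj] at hxy
      simp only [Finset.coe_empty, Set.mem_insert_iff]
      tauto
    · intro a ha
      simp only [Finset.coe_empty, Set.mem_insert_iff, Set.mem_empty_iff_false, or_false] at ha
      rcases ha with rfl | rfl
      · exact Adj.reachable (by simp [edge_adj, hpq.symm])
      · exact Reachable.refl _
    · intro C hC h
      obtain ⟨a, ha⟩ := hC.nonempty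
      exact hC.notMem_support h (hN a) ha
  | insert x Y hx ih =>
    intro hq p hp hpq
    simp only [Finset.mem_insert, not_or] at hq hp
    obtain ⟨D, hsupp, hconn, hcyc, hdeg, hdx, hdq⟩ := ih hq.2 x hx (Ne.symm hq.1)
    have hpD : p ∉ D.support := fun h => by
      have := hsupp h
      simp only [Set.mem_insert_iff, Finset.mem_coe] at this
      tauto
    have hadj := sup_edge_adj (D := D) hp.1
    have hNp : (D ⊔ edge p x).neighborSet p ⊆ {x} := by
      intro y hy
      rw [mem_neighborSet, hadj] at hy
      rcases hy with hy | hy | hy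
      · exact absurd hy.mem_support_left hpD
      · exact hy.2
      · exact absurd hy.1 hp.1
    have hNx : (D ⊔ edge p x).neighborSet x ⊆ insert p (D.neighborSet x) := by
      intro y hy
      rw [mem_neighborSet, hadj] at hy
      simp only [Set.mem_insert_iff, mem_neighborSet]
      grind
    have hNe : ∀ e, e ≠ p → e ≠ x → (D ⊔ edge p x).neighborSet e ⊆ D.neighborSet e := by
      intro e hep hex y hy
      rw [mem_neighborSet, hadj] at hy
      rw [mem_neighborSet]
      grind
    have hNp1 : ((D ⊔ edge p x).neighborSet p).encard ≤ 1 :=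
      (Set.encard_le_encard hNp).trans (Set.encard_singleton x).le
    refine ⟨D ⊔ edge p x, ?_, ?_, ?_, ?_, hNp1, ?_⟩
    · intro y hy
      obtain ⟨z, hyz⟩ := hy
      have hyz : (D ⊔ edge p x).Adj y z := hyz
      rw [hadj] at hyz
      simp only [Finset.coe_insert, Set.mem_insert_iff]
      rcases hyz with h | h | h
      · have := hsupp h.mem_support_left
        simp only [Set.mem_insert_iff] at this
        tauto
      · exact Or.inl h.1
      · exact Or.inr (Or.inr (Or.inl h.1))
    · intro a ha
      simp only [Finset.coe_insert, Set.mem_insert_iff] at ha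
      have hr : ∀ b ∈ insert x (insert q (Y : Set W)), (D ⊔ edge p x).Reachable q b :=
        fun b hb => (hconn b hb).mono le_sup_left
      rcases ha with rfl | rfl | rfl | ha
      · exact (hr x (by simp)).trans (Adj.reachable ((hadj _ _).2 (by simp)))
      · exact hr _ (by simp)
      · exact hr _ (by simp)
      · exact hr a (by simp [ha])
    · exact fun C hC h => hcyc C hC (hC.le_of_le_sup_edge hp.1 hpD h)
    · intro e
      by_cases hep : e = p
      · rw [hep]; exact hNp1.trans (by norm_num)
      by_cases hex : e = x
      · rw [hex]
        refine (Set.encard_le_encard hNx).trans ((Set.encard_insert_le _ _).trans ?_)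
        exact (add_le_add_left hdx 1).trans (by norm_num)
      · exact (Set.encard_le_encard (hNe e hep hex)).trans (hdeg e)
    · exact (Set.encard_le_encard (hNe q (Ne.symm hpq) hq.1)).trans hdq

/-- A finite clique, all but at most two of whose vertices may lie in two blocks, carries a
cell. -/
theorem exists_cellSpec_of_clique {L : SimpleGraph W} {X : Set W} (hX : X.Finite) {w : W → ℕ}
    (hclique : ∀ a ∈ X, ∀ b ∈ X, a ≠ b → L.Adj a b)
    (hw : X.Nontrivial → (∀ e ∈ X, 1 ≤ w e) ∧ {e | e ∈ X ∧ w e < 2}.encard ≤ 2) :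
    ∃ D Z, CellSpec L X w D Z := by
  classical
  by_cases hnt : X.Nontrivial
  · obtain ⟨hw1, hw2⟩ := hw hnt
    have hX2 : 2 ≤ X.encard := by
      rw [← one_add_one_eq_two]
      exact Order.add_one_le_of_lt (Set.one_lt_encard_iff_nontrivial.2 hnt)
    obtain ⟨T, hPT, hTX, hT⟩ := Set.exists_superset_subset_encard_eq
      (s := {e | e ∈ X ∧ w e < 2}) (t := X) (fun e he => he.1) hw2 hX2
    obtain ⟨q, p, hqp, rfl⟩ := Set.encard_eq_two.1 hT
    set Y : Finset W := (hX.sdiff (t := {q, p})).toFinset with hY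
    have hmemY : ∀ a, a ∈ Y ↔ a ∈ X ∧ a ≠ q ∧ a ≠ p := by
      intro a
      simp [hY]
    obtain ⟨D, hsupp, hconn, hcyc, hdeg, hdp, hdq⟩ :=
      exists_path Y (q := q) (by simp [hmemY]) p (by simp [hmemY]) hqp.symm
    have hset : insert p (insert q (Y : Set W)) = X := by
      ext a
      have h1 : q ∈ X := hTX (by simp)
      have h2 : p ∈ X := hTX (by simp)
      simp only [Set.mem_insert_iff, Finset.mem_coe, hmemY]
      grind
    rw [hset] at hsupp hconn
    have hmem : ∀ a b, D.Adj a b → a ∈ X := fun a b h => hsupp h.mem_support_left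
    refine ⟨D, ⊥, CellSpec.of_acyclic (fun a b h => hclique a (hmem a b h) b (hmem b a h.symm) h.ne)
      hmem (fun a ha b hb => (hconn a ha).symm.trans (hconn b hb)) hcyc fun e he => ?_⟩
    by_cases h2 : w e < 2
    · have h1 := hw1 e he
      have : w e = 1 := by omega
      rw [this]
      rcases hPT ⟨he, h2⟩ with h | h
      · rw [h]; exact_mod_cast hdq
      · rw [Set.mem_singleton_iff.1 h]; exact_mod_cast hdp
    · refine (hdeg e).trans ?_
      exact_mod_cast not_lt.1 h2
  · rw [Set.not_nontrivial_iff] at hnt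
    refine ⟨⊥, ⊥, CellSpec.of_acyclic bot_le (fun a b h => h.elim)
      (fun a ha b hb => hnt ha hb ▸ Reachable.refl _) ?_ (by simp)⟩
    intro C hC h
    obtain ⟨a, b, hab⟩ := hC.nonempty
    exact h hab

/-! ### Trees of cells -/

/-- A cycle contained in `H`, as a subgraph of `H`. -/
def cycSubgraph {Z H : SimpleGraph W} (h : Z ≤ H) : H.Subgraph where
  verts := Z.support
  Adj := Z.Adj
  adj_sub hab := h hab
  edge_vert hab := hab.mem_support_left
  symm := ⟨fun _ _ hab => hab.symm⟩

theorem IsCyc.isCycleSub {Z H : SimpleGraph W} (hZ : IsCyc Z) (h : Z ≤ H) :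
    IsCycleSub (cycSubgraph h) := by
  refine ⟨hZ.finite, hZ.nonempty, ?_, hZ.deg⟩
  rw [Subgraph.connected_iff]
  refine ⟨⟨?_⟩, hZ.nonempty⟩
  rintro ⟨a, ha⟩ ⟨b, hb⟩
  have key : ∃ hb' : b ∈ Z.support, (cycSubgraph h).coe.Reachable ⟨a, ha⟩ ⟨b, hb'⟩ := by
    refine reachable_induction (p := fun b => ∃ hb' : b ∈ Z.support,
      (cycSubgraph h).coe.Reachable ⟨a, ha⟩ ⟨b, hb'⟩) (hZ.conn a ha b hb)
      ⟨ha, Reachable.refl _⟩ ?_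
    rintro x y ⟨hx, hr⟩ hxy
    exact ⟨hxy.mem_support_right, hr.trans (Adj.reachable (show Z.Adj x y from hxy))⟩
  exact key.2

theorem CellSpec.support_subset {L D Z : SimpleGraph W} {X : Set W} {w : W → ℕ}
    (h : CellSpec L X w D Z) : Z.support ⊆ X := by
  intro a ha
  obtain ⟨b, hab⟩ := ha
  exact h.mem a b (h.cycle_le hab)

theorem CellSpec.count_le {L D Z : SimpleGraph W} {X : Set W} {w : W → ℕ}
    (h : CellSpec L X w D Z) (e : W) : {C | C = Z ∧ e ∈ Z.support}.encard +
    {f | D.Adj e f ∧ ¬ Z.Adj e f}.encard ≤ w e := by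
  by_cases he : e ∈ X
  · exact h.count e he
  · have h1 : {C | C = Z ∧ e ∈ Z.support} = ∅ :=
      Set.eq_empty_iff_forall_notMem.2 fun C hC => he (h.support_subset hC.2)
    have h2 : {f | D.Adj e f ∧ ¬ Z.Adj e f} = ∅ :=
      Set.eq_empty_iff_forall_notMem.2 fun f hf => he (h.mem e f hf.1)
    simp [h1, h2]

theorem CellSpec.encard_neighborSet_le {L D Z : SimpleGraph W} {X : Set W} {w : W → ℕ}
    (h : CellSpec L X w D Z) (e : W) : (D.neighborSet e).encard ≤ 2 * w e := by
  have hsub : D.neighborSet e ⊆ Z.neighborSet e ∪ {f | D.Adj e f ∧ ¬ Z.Adj e f} := by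
    intro f hf
    by_cases hZ : Z.Adj e f
    · exact Or.inl hZ
    · exact Or.inr ⟨hf, hZ⟩
  have h1 : (Z.neighborSet e).encard ≤ 2 * {C | C = Z ∧ e ∈ Z.support}.encard := by
    by_cases he : e ∈ Z.support
    · have hZ : IsCyc Z := by
        rcases h.cycle with h' | h'
        · rw [h'] at he; simp at he
        · exact h'
      have h2 : {C | C = Z ∧ e ∈ Z.support} = {Z} := by ext C; simp [he]
      rw [h2, Set.encard_singleton, ← (hZ.finite_neighborSet he).cast_ncard_eq, hZ.deg e he]
      norm_num
    · have h2 : Z.neighborSet e = ∅ :=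
        Set.eq_empty_iff_forall_notMem.2 fun f hf => he (Adj.mem_support_left hf)
      simp [h2]
  refine (Set.encard_le_encard hsub).trans ((Set.encard_union_le _ _).trans ?_)
  refine le_trans (add_le_add h1 (le_mul_of_one_le_left zero_le one_le_two)) ?_
  rw [← mul_add]
  gcongr
  exact h.count_le e

/-- The cells `X i` form a rooted tree: each `e` has a home cell, all other cells containing `e`
are deeper, and at most one element of each cell has its home elsewhere. -/
structure CellTree {ι : Type*} (L : SimpleGraph W) (X : ι → Set W) (w : ι → W → ℕ)
    (D Z : ι → SimpleGraph W) (home : W → ι) (depth : ι → ℕ) : Prop where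
  spec : ∀ i, CellSpec L (X i) (w i) (D i) (Z i)
  home_or : ∀ i e, e ∈ X i → home e = i ∨ depth (home e) < depth i
  entry : ∀ i e e', e ∈ X i → e' ∈ X i → home e ≠ i → home e' ≠ i → e = e'
  two : ∀ e, ∃ i j, (∀ k, e ∈ X k → k = i ∨ k = j) ∧ w i e + w j e ≤ 2

namespace CellTree

variable {ι : Type*} {L : SimpleGraph W} {X : ι → Set W} {w : ι → W → ℕ}
  {D Z : ι → SimpleGraph W} {home : W → ι} {depth : ι → ℕ}

/-- Different cells share at most one element. -/
theorem cell_eq (h : CellTree L X w D Z home depth) {i j : ι} {e f : W} (hne : e ≠ f)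
    (hei : e ∈ X i) (hfi : f ∈ X i) (hej : e ∈ X j) (hfj : f ∈ X j) : i = j := by
  by_contra hij
  have h1 := h.home_or i e hei
  have h2 := h.home_or i f hfi
  have h3 := h.home_or j e hej
  have h4 := h.home_or j f hfj
  have h5 := h.entry i e f hei hfi
  have h6 := h.entry j e f hej hfj
  have h5' : home e = i ∨ home f = i := by by_contra! h'; exact hne (h5 h'.1 h'.2)
  have h6' : home e = j ∨ home f = j := by by_contra! h'; exact hne (h6 h'.1 h'.2)
  clear h5 h6
  grind

/-- Every cycle of the union of all cells lies in one cell. -/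
theorem exists_cycle_eq (h : CellTree L X w D Z home depth) {C : SimpleGraph W} (hC : IsCyc C)
    (hle : C ≤ ⨆ i, D i) : ∃ i, C = Z i := by
  obtain ⟨x, hx, hmax⟩ := hC.finite.exists_maximalFor (fun e => depth (home e)) _ hC.nonempty
  replace hmax : ∀ y ∈ C.support, depth (home y) ≤ depth (home x) := fun y hy => by
    by_contra hlt
    exact hlt (hmax hy (le_of_lt (not_le.1 hlt)))
  set i := home x with hi
  have hedge : ∀ y z, C.Adj y z → home y = i → (D i).Adj y z := by
    intro y z hyz hy
    obtain ⟨j, hj⟩ := iSup_adj.1 (hle hyz)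
    have hyj := (h.spec j).mem y z hj
    have hzj := (h.spec j).mem z y hj.symm
    have h1 := h.home_or j y hyj
    have h2 := h.home_or j z hzj
    have h3 := h.entry j y z hyj hzj
    have h4 := hmax z hyz.mem_support_right
    have h5 := hyz.ne
    have : j = i := by grind
    exact this ▸ hj
  set Y : Set W := {y | y ∈ C.support ∧ home y = i} with hY
  have hxY : x ∈ Y := ⟨hx, rfl⟩
  have hYfin : Y.Finite := hC.finite.subset fun y hy => hy.1
  refine ⟨i, (h.spec i).uniq C hC fun p q hpq => ?_⟩
  suffices hpq' : p ∈ Y ∨ q ∈ Y by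
    rcases hpq' with hp | hq
    · exact hedge p q hpq hp.2
    · exact (hedge q p hpq.symm hq.2).symm
  by_cases hclosed : ∀ y ∈ Y, ∀ z, C.Adj y z → z ∈ Y
  · exact Or.inl (hC.subset_of_closed hx hxY hclosed hpq.mem_support_left)
  · push Not at hclosed
    obtain ⟨y, hyY, v, hyv, hvY⟩ := hclosed
    have hvi : ∀ y ∈ Y, ∀ z, C.Adj y z → z ∉ Y → z = v := by
      intro y' hy' z hyz hz
      refine h.entry i z v ((h.spec i).mem z y' (hedge y' z hyz hy'.2).symm)
        ((h.spec i).mem v y (hedge y v hyv hyY.2).symm)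
        (fun h' => hz ⟨hyz.mem_support_right, h'⟩) (fun h' => hvY ⟨hyv.mem_support_right, h'⟩)
    have hnb : ∀ b, C.Adj v b → b ∈ Y := fun b hb =>
      neighbors_mem_of_leaving hYfin hvY (fun y hy => hC.deg y hy.1) hvi
        (hC.deg v hyv.mem_support_right) hyY hyv.symm hb
    have hsub : C.support ⊆ insert v Y := by
      refine hC.subset_of_closed hx (Or.inr hxY) ?_
      rintro a (rfl | ha) b hab
      · exact Or.inr (hnb b hab)
      · by_cases hb : b ∈ Y
        · exact Or.inr hb
        · exact Or.inl (hvi a ha b hab hb)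
    rcases hsub hpq.mem_support_left with hp | hp
    · exact Or.inr (hnb q (hp ▸ hpq))
    · exact Or.inl hp

theorem evenCycles (h : CellTree L X w D Z home depth) : EvenCycles (⨆ i, D i) := by
  intro C hC
  obtain ⟨i, hi⟩ := h.exists_cycle_eq hC.isCyc C.spanningCoe_le
  have := (h.spec i).even
  rwa [← hi, hC.support_eq] at this

theorem le (h : CellTree L X w D Z home depth) : (⨆ i, D i) ≤ L :=
  iSup_le fun i => (h.spec i).le

theorem isSemiCactus (h : CellTree L X w D Z home depth) (hconn : (⨆ i, D i).Connected) :
    IsSemiCactus (⨆ i, D i) := by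
  have hadj : ∀ e f, (⨆ i, D i).Adj e f → ∀ i j, (∀ k, e ∈ X k → k = i ∨ k = j) →
      (D i).Adj e f ∨ (D j).Adj e f := by
    intro e f hef i j hij
    obtain ⟨k, hk⟩ := iSup_adj.1 hef
    rcases hij k ((h.spec k).mem e f hk) with rfl | rfl
    · exact Or.inl hk
    · exact Or.inr hk
  refine ⟨hconn, ?_, ?_, ?_⟩
  · intro e
    obtain ⟨i, j, hij, hw⟩ := h.two e
    have hle : ((⨆ i, D i).neighborSet e).encard ≤ (4 : ℕ) := by
      have hsub : (⨆ i, D i).neighborSet e ⊆ (D i).neighborSet e ∪ (D j).neighborSet e :=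
        fun f hf => hadj e f hf i j hij
      refine (Set.encard_le_encard hsub).trans ((Set.encard_union_le _ _).trans ?_)
      refine le_trans (add_le_add ((h.spec i).encard_neighborSet_le e)
        ((h.spec j).encard_neighborSet_le e)) ?_
      rw [← mul_add]
      have : 2 * (w i e + w j e) ≤ 4 := by omega
      exact_mod_cast this
    exact ⟨Set.finite_of_encard_le_coe hle,
      (ENat.natCast_le_natCast.1 ((Set.ncard_le_encard _).trans hle))⟩
  · intro C₁ C₂ h1 h2 hne
    obtain ⟨i, hi⟩ := h.exists_cycle_eq h1.isCyc C₁.spanningCoe_le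
    obtain ⟨j, hj⟩ := h.exists_cycle_eq h2.isCyc C₂.spanningCoe_le
    rw [Set.disjoint_left]
    intro e
    induction e using Sym2.ind with
    | _ a b =>
      intro he1 he2
      have ha1 : (Z i).Adj a b := by rw [← hi]; exact he1
      have ha2 : (Z j).Adj a b := by rw [← hj]; exact he2
      have d1 := (h.spec i).cycle_le ha1
      have d2 := (h.spec j).cycle_le ha2
      have := h.cell_eq ha1.ne ((h.spec i).mem _ _ d1) ((h.spec i).mem _ _ d1.symm)
        ((h.spec j).mem _ _ d2) ((h.spec j).mem _ _ d2.symm)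
      subst this
      exact hne (h1.ext_spanningCoe h2 (hi.trans hj.symm))
  · intro e
    obtain ⟨i, j, hij, hw⟩ := h.two e
    have hcyc : {C : (⨆ i, D i).Subgraph | IsCycleSub C ∧ e ∈ C.verts}.encard ≤
        {C | C = Z i ∧ e ∈ (Z i).support}.encard + {C | C = Z j ∧ e ∈ (Z j).support}.encard := by
      have hinj : Set.InjOn (fun C : (⨆ i, D i).Subgraph => C.spanningCoe)
          {C | IsCycleSub C ∧ e ∈ C.verts} :=
        fun C hC C' hC' heq => hC.1.ext_spanningCoe hC'.1 heq
      rw [← hinj.encard_image]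
      refine (Set.encard_le_encard ?_).trans (Set.encard_union_le _ _)
      rintro _ ⟨C, ⟨hC, heC⟩, rfl⟩
      obtain ⟨k, hk⟩ := h.exists_cycle_eq hC.isCyc C.spanningCoe_le
      rw [← hC.support_eq, hk] at heC
      rcases hij k ((h.spec k).support_subset heC) with rfl | rfl
      · exact Or.inl ⟨hk, heC⟩
      · exact Or.inr ⟨hk, heC⟩
    have hbr : {b : Sym2 W | b ∈ (⨆ i, D i).edgeSet ∧ e ∈ b ∧
        ∀ C : (⨆ i, D i).Subgraph, IsCycleSub C → b ∉ C.edgeSet}.encard ≤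
        {f | (D i).Adj e f ∧ ¬ (Z i).Adj e f}.encard +
          {f | (D j).Adj e f ∧ ¬ (Z j).Adj e f}.encard := by
      refine le_trans (Set.encard_le_encard (t := (fun f => s(e, f)) ''
        ({f | (D i).Adj e f ∧ ¬ (Z i).Adj e f} ∪ {f | (D j).Adj e f ∧ ¬ (Z j).Adj e f})) ?_)
        ((Set.encard_image_le _ _).trans (Set.encard_union_le _ _))
      rintro b ⟨hb, heb, hbC⟩
      obtain ⟨f, rfl⟩ := heb
      have hZ : ∀ k, ¬ (Z k).Adj e f := by
        intro k hk
        rcases (h.spec k).cycle with h' | h'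
        · rw [h'] at hk; exact hk
        · exact hbC _ (h'.isCycleSub (((h.spec k).cycle_le).trans (le_iSup D k))) hk
      refine ⟨f, ?_, rfl⟩
      rcases hadj e f hb i j hij with h' | h'
      · exact Or.inl ⟨h', hZ i⟩
      · exact Or.inr ⟨h', hZ j⟩
    refine (add_le_add hcyc hbr).trans ?_
    rw [add_add_add_comm]
    refine (add_le_add ((h.spec i).count_le e) ((h.spec j).count_le e)).trans ?_
    exact_mod_cast hw

end CellTree

/-! ### Faithfulness -/

/-- An infinite walk that visits every vertex only finitely often contains a ray. -/
theorem exists_ray_of_walk {H : SimpleGraph W} {q : ℕ → W}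
    (hq : ∀ n, q n = q (n + 1) ∨ H.Adj (q n) (q (n + 1))) (hfin : ∀ g, {n | q n = g}.Finite) :
    ∃ t : ℕ → ℕ, StrictMono t ∧ IsRay H (q ∘ t) := by
  have hlast : ∀ n, ∃ m, n ≤ m ∧ q m = q n ∧ ∀ k, m < k → q k ≠ q n := by
    intro n
    obtain ⟨m, hm, hmax⟩ := (hfin (q n)).exists_maximalFor id _ ⟨n, rfl⟩
    refine ⟨m, ?_, hm, fun k hk hkn => ?_⟩
    · by_contra hlt
      exact hlt (hmax (j := n) rfl (le_of_lt (not_le.1 hlt)))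
    · exact absurd (hmax (j := k) hkn hk.le) (not_le.2 hk)
  choose l hl1 hl2 hl3 using hlast
  let t : ℕ → ℕ := fun k => Nat.rec (l 0) (fun _ m => l (m + 1)) k
  have ht : ∀ k, t (k + 1) = l (t k + 1) := fun k => rfl
  have hmono : StrictMono t := strictMono_nat_of_lt_succ fun k => by
    rw [ht]
    exact Nat.lt_of_succ_le (hl1 (t k + 1))
  have havoid : ∀ k m, t k < m → q m ≠ q (t k) := by
    intro k m hm
    cases k with
    | zero => rw [show t 0 = l 0 from rfl, hl2] ; exact hl3 0 m hm
    | succ k =>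
      rw [ht] at hm ⊢
      rw [hl2]
      exact hl3 _ m hm
  refine ⟨t, hmono, ?_, fun k => ?_⟩
  · intro a b hab
    by_contra hne
    rcases lt_or_gt_of_ne hne with hlt | hlt
    · exact havoid a (t b) (hmono hlt) hab.symm
    · exact havoid b (t a) (hmono hlt) hab
  · have h1 : q (t (k + 1)) = q (t k + 1) := by rw [ht, hl2]
    simp only [Function.comp]
    rw [h1]
    exact (hq (t k)).resolve_left (havoid k _ (Nat.lt_succ_self _)).symm

theorem mem_of_mem_support_del {H : SimpleGraph W} {N : Set W} {a b x : W}
    (p : (del H Nᶜ).Walk a b) (ha : a ∈ N) (hx : x ∈ p.support) : x ∈ N := by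
  induction p with
  | nil => simp at hx; exact hx ▸ ha
  | cons h p ih =>
    rw [Walk.support_cons, List.mem_cons] at hx
    rcases hx with rfl | hx
    · exact ha
    · exact ih (by simpa using h.2.2) hx

/-- Infinitely many consecutive walks form one infinite walk; `s n` is the starting time of the
`n`-th walk. -/
theorem exists_concat {H : SimpleGraph W} {R : ℕ → W} (p : ∀ n, H.Walk (R n) (R (n + 1))) :
    ∃ q : ℕ → W, ∃ s : ℕ → ℕ, StrictMono s ∧
      (∀ k, ∃ n j, j ≤ (p n).length ∧ s n + j = k ∧ q k = (p n).getVert j) ∧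
      (∀ k, q k = q (k + 1) ∨ H.Adj (q k) (q (k + 1))) ∧ ∀ n, q (s n) = R n := by
  let step : ℕ × ℕ → ℕ × ℕ := fun x =>
    if x.2 < (p x.1).length then (x.1, x.2 + 1) else (x.1 + 1, 0)
  let f : ℕ → ℕ × ℕ := fun k => step^[k] (0, 0)
  let s : ℕ → ℕ := fun n => ∑ i ∈ Finset.range n, ((p i).length + 1)
  have hs : ∀ n, s (n + 1) = s n + ((p n).length + 1) := fun n => Finset.sum_range_succ _ _
  have hf : ∀ k, f (k + 1) = step (f k) := fun k => Function.iterate_succ_apply' _ _ _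
  have hinv : ∀ k, (f k).2 ≤ (p (f k).1).length ∧ s (f k).1 + (f k).2 = k := by
    intro k
    induction k with
    | zero => simp [f, s]
    | succ k ih =>
      rw [hf]
      by_cases h : (f k).2 < (p (f k).1).length
      · rw [show step (f k) = ((f k).1, (f k).2 + 1) from if_pos h]
        exact ⟨h, by dsimp only; omega⟩
      · rw [show step (f k) = ((f k).1 + 1, 0) from if_neg h]
        exact ⟨Nat.zero_le _, by rw [hs]; omega⟩
  have hmono : StrictMono s := strictMono_nat_of_lt_succ fun n => by rw [hs]; omega
  have hfs : ∀ n, f (s n) = (n, 0) := by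
    intro n
    obtain ⟨h1, h2⟩ := hinv (s n)
    have h3 : (f (s n)).1 = n := by
      rcases lt_trichotomy (f (s n)).1 n with h | h | h
      · have := hmono.monotone (Nat.succ_le_of_lt h)
        rw [Nat.succ_eq_add_one, hs] at this
        omega
      · exact h
      · have := hmono h
        omega
    ext
    · exact h3
    · rw [h3] at h2
      simpa using h2
  refine ⟨fun k => (p (f k).1).getVert (f k).2, s, hmono,
    fun k => ⟨_, _, (hinv k).1, (hinv k).2, rfl⟩, fun k => ?_, fun n => ?_⟩
  · beta_reduce
    rw [hf]
    by_cases h : (f k).2 < (p (f k).1).length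
    · rw [show step (f k) = ((f k).1, (f k).2 + 1) from if_pos h]
      exact Or.inr ((p _).adj_getVert_succ h)
    · rw [show step (f k) = ((f k).1 + 1, 0) from if_neg h, Walk.getVert_zero]
      exact Or.inl ((p _).getVert_of_length_le (not_lt.1 h))
  · simp only [hfs, Walk.getVert_zero]

/-- A spanning subgraph `D` of `L` is faithful if adjacent vertices of `L` are connected in `D`
within sets `N i` such that every vertex lies in only finitely many of these sets. -/
theorem faithful_of_local {ι : Type*} {D L : SimpleGraph W} (hle : D ≤ L) (K N : ι → Set W)
    (hK : ∀ i, (K i).Finite) (hadj : ∀ e f, L.Adj e f → ∃ i, e ∈ K i ∧ f ∈ K i)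
    (hconn : ∀ i, ∀ e ∈ K i, ∀ f ∈ K i, (del D (N i)ᶜ).Reachable e f)
    (hfin : ∀ g, {i | g ∈ N i}.Finite) (hKN : ∀ i, K i ⊆ N i) : Faithful D L := by
  refine ⟨fun R hR => ?_, fun R₁ R₂ h1 h2 => ⟨fun h S hS => ?_, fun h S hS => ?_⟩⟩
  · have hstep : ∀ n, ∃ i, ∃ p : D.Walk (R n) (R (n + 1)),
        R n ∈ K i ∧ ∀ x ∈ p.support, x ∈ N i := by
      intro n
      obtain ⟨i, hi1, hi2⟩ := hadj _ _ (hR.2 n)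
      obtain ⟨p⟩ := hconn i _ hi1 _ hi2
      refine ⟨i, p.mapLe (show del D (N i)ᶜ ≤ D from fun _ _ h => h.1), hi1, fun x hx => ?_⟩
      rw [Walk.support_mapLe_eq_support] at hx
      exact mem_of_mem_support_del p (hKN i hi1) hx
    choose i p hiK hpN using hstep
    obtain ⟨q, s, hs1, hs2, hq, hqR⟩ := exists_concat p
    have hfinq : ∀ g, {k | q k = g}.Finite := by
      intro g
      have hA : {n | g ∈ N (i n)}.Finite := by
        have : {n | g ∈ N (i n)} ⊆ R ⁻¹' (⋃ j ∈ {j | g ∈ N j}, K j) := by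
          intro n hn
          simp only [Set.mem_preimage, Set.mem_iUnion]
          exact ⟨i n, hn, hiK n⟩
        exact (((hfin g).biUnion fun j _ => hK j).preimage hR.1.injOn).subset this
      refine (hA.biUnion fun n _ =>
        ((Set.finite_Iic (p n).length).image fun j => s n + j)).subset ?_
      intro k hk
      obtain ⟨n, j, hj, rfl, hqk⟩ := hs2 k
      simp only [Set.mem_iUnion]
      exact ⟨n, by
        have := hpN n _ ((p n).getVert_mem_support j)
        rwa [← hqk, hk] at this, j, hj, rfl⟩
    obtain ⟨t, ht, hray⟩ := exists_ray_of_walk hq hfinq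
    refine ⟨q ∘ t, hray, fun S hS => ?_⟩
    obtain ⟨M, hM⟩ := (hS.biUnion fun g _ => hfinq g).bddAbove
    have hlate : ∀ k, M < k → q k ∉ S := fun k hk hkS => by
      refine absurd (hM (a := k) ?_) (not_le.2 hk)
      simp only [Set.mem_iUnion]
      exact ⟨q k, hkS, rfl⟩
    have hreach : ∀ k, (del L S).Reachable (q (M + 1)) (q (M + 1 + k)) := by
      intro k
      induction k with
      | zero => exact Reachable.refl _
      | succ k ih =>
        refine ih.trans ?_
        rcases hq (M + 1 + k) with h | h
        · rw [← add_assoc, ← h]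
        · exact Adj.reachable ⟨hle h, hlate _ (by omega), hlate _ (by omega)⟩
    have hreach' : ∀ k, M < k → (del L S).Reachable (q (M + 1)) (q k) := fun k hk => by
      have := hreach (k - (M + 1))
      rwa [Nat.add_sub_cancel' hk] at this
    have hlt : ∀ n, M + 1 ≤ n → M < s n := fun n hn => hn.trans (hs1.le_apply)
    refine ⟨M + 1, M + 1, fun n hn => ?_, fun n hn => hlate _ (hn.trans ht.le_apply), ?_⟩
    · rw [← hqR]
      exact hlate _ (hlt n hn)
    · rw [← hqR]
      exact (hreach' _ (hlt _ le_rfl)).symm.trans (hreach' _ (Nat.lt_of_succ_le ht.le_apply))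
  · obtain ⟨m, n, hm, hn, hr⟩ := h S hS
    exact ⟨m, n, hm, hn, hr.mono (del_mono hle S)⟩
  · set T : Set W := S ∪ ⋃ g ∈ S, ⋃ i ∈ {i | g ∈ N i}, K i with hT
    have hTfin : T.Finite :=
      hS.union (hS.biUnion fun g _ => (hfin g).biUnion fun i _ => hK i)
    obtain ⟨m, n, hm, hn, hr⟩ := h T hTfin
    refine ⟨m, n, fun i hi hS' => hm i hi (Or.inl hS'), fun i hi hS' => hn i hi (Or.inl hS'), ?_⟩
    refine reachable_of_forall_adj hr ?_
    rintro x y ⟨hxy, hx, -⟩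
    obtain ⟨i, hxi, hyi⟩ := hadj x y hxy
    refine (hconn i x hxi y hyi).mono (del_anti ?_)
    intro g hg hgi
    exact hx (Or.inr (by simp only [Set.mem_iUnion]; exact ⟨g, hg, i, hgi, hxi⟩))

/-! ### Blocks -/

theorem reachable_subtype_iff {B : Set V} {H : SimpleGraph B} {K : SimpleGraph V}
    (h : ∀ a b : B, H.Adj a b ↔ K.Adj a b) (hB : ∀ a b, K.Adj a b → b ∈ B) (a b : B) :
    H.Reachable a b ↔ K.Reachable a b := by
  refine ⟨fun hr => hr.map (⟨Subtype.val, fun hab => (h _ _).1 hab⟩ : H →g K), fun hr => ?_⟩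
  have key : ∃ hb : (b : V) ∈ B, H.Reachable a ⟨b, hb⟩ := by
    refine reachable_induction (p := fun b => ∃ hb : b ∈ B, H.Reachable a ⟨b, hb⟩) hr
      ⟨a.2, Reachable.refl _⟩ ?_
    rintro x y ⟨hx, hr⟩ hxy
    exact ⟨hB x y hxy, hr.trans (Adj.reachable ((h _ _).2 hxy))⟩
  exact key.2

theorem del_le (G : SimpleGraph V) (S : Set V) : del G S ≤ G := fun _ _ h => h.1

/-- `B` induces a nonseparable graph, expressed on the vertex type of `G`. -/
structure Nonsep (G : SimpleGraph V) (B : Set V) : Prop where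
  nonempty : B.Nonempty
  conn : ∀ a ∈ B, ∀ b ∈ B, (del G Bᶜ).Reachable a b
  cut : ∀ v, ∀ a ∈ B, ∀ b ∈ B, a ≠ v → b ≠ v → (del G (Bᶜ ∪ {v})).Reachable a b

theorem reachable_induce_iff {G : SimpleGraph V} {B : Set V} (a b : B) :
    (G.induce B).Reachable a b ↔ (del G Bᶜ).Reachable a b := by
  refine reachable_subtype_iff (fun a b => ?_) (fun a b hab => by simpa using hab.2.2) a b
  exact ⟨fun h => ⟨h, by simp, by simp⟩, fun h => h.1⟩

theorem nonseparable_induce_iff {G : SimpleGraph V} {B : Set V} :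
    Nonseparable (G.induce B) ↔ Nonsep G B := by
  have hcut : ∀ v a b : B, (del (G.induce B) {v}).Reachable a b ↔
      (del G (Bᶜ ∪ {(v : V)})).Reachable a b := by
    intro v a b
    refine reachable_subtype_iff (fun a b => ?_) (fun a b hab => ?_) a b
    · simp [del, Subtype.ext_iff]
    · by_contra hb
      exact hab.2.2 (Or.inl hb)
  constructor
  · rintro ⟨h1, h2⟩
    have hconn : ∀ a ∈ B, ∀ b ∈ B, (del G Bᶜ).Reachable a b := fun a ha b hb =>
      (reachable_induce_iff ⟨a, ha⟩ ⟨b, hb⟩).1 (h1.preconnected _ _)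
    refine ⟨Set.nonempty_coe_sort.1 h1.nonempty, hconn, fun v a ha b hb hav hbv => ?_⟩
    by_cases hv : v ∈ B
    · by_contra hr
      refine h2 ⟨v, hv⟩ ⟨⟨a, ha⟩, ⟨b, hb⟩, by simpa [Subtype.ext_iff] using hav,
        by simpa [Subtype.ext_iff] using hbv, h1.preconnected _ _, ?_⟩
      rwa [hcut]
    · rw [Set.union_eq_self_of_subset_right (by simpa using hv)]
      exact hconn a ha b hb
  · intro h
    have : Nonempty B := h.nonempty.to_subtype
    refine ⟨⟨fun a b => (reachable_induce_iff a b).2 (h.conn a a.2 b b.2)⟩, ?_⟩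
    rintro v ⟨a, b, ha, hb, -, hr⟩
    rw [hcut] at hr
    exact hr (h.cut v a a.2 b b.2 (by simpa [Subtype.ext_iff] using ha)
      (by simpa [Subtype.ext_iff] using hb))

theorem Nonsep.cut_of_subset {G : SimpleGraph V} {A B : Set V} (h : Nonsep G A) (hAB : A ⊆ B)
    (v : V) {a b : V} (ha : a ∈ A) (hb : b ∈ A) (hav : a ≠ v) (hbv : b ≠ v) :
    (del G (Bᶜ ∪ {v})).Reachable a b :=
  (h.cut v a ha b hb hav hbv).mono
    (del_anti (Set.union_subset_union_left _ (Set.compl_subset_compl.2 hAB)))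

theorem Nonsep.conn_of_subset {G : SimpleGraph V} {A B : Set V} (h : Nonsep G A) (hAB : A ⊆ B)
    {a b : V} (ha : a ∈ A) (hb : b ∈ A) : (del G Bᶜ).Reachable a b :=
  (h.conn a ha b hb).mono (del_anti (Set.compl_subset_compl.2 hAB))

theorem Nonsep.union {G : SimpleGraph V} {A B : Set V} (hA : Nonsep G A) (hB : Nonsep G B)
    {x y : V} (hxy : x ≠ y) (hxA : x ∈ A) (hxB : x ∈ B) (hyA : y ∈ A) (hyB : y ∈ B) :
    Nonsep G (A ∪ B) := by
  have key : ∀ v z, z ∈ A → z ∈ B → z ≠ v → ∀ a ∈ A ∪ B, a ≠ v →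
      (del G ((A ∪ B)ᶜ ∪ {v})).Reachable z a := by
    rintro v z hzA hzB hzv a (ha | ha) hav
    · exact hA.cut_of_subset Set.subset_union_left v hzA ha hzv hav
    · exact hB.cut_of_subset Set.subset_union_right v hzB ha hzv hav
  have key' : ∀ a ∈ A ∪ B, (del G (A ∪ B)ᶜ).Reachable x a := by
    rintro a (ha | ha)
    · exact hA.conn_of_subset Set.subset_union_left hxA ha
    · exact hB.conn_of_subset Set.subset_union_right hxB ha
  refine ⟨⟨x, Or.inl hxA⟩, fun a ha b hb => (key' a ha).symm.trans (key' b hb), ?_⟩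
  intro v a ha b hb hav hbv
  by_cases hxv : x = v
  · have hyv : y ≠ v := hxv ▸ hxy.symm
    exact (key v y hyA hyB hyv a ha hav).symm.trans (key v y hyA hyB hyv b hb hbv)
  · exact (key v x hxA hxB hxv a ha hav).symm.trans (key v x hxA hxB hxv b hb hbv)

theorem nonsep_pair {G : SimpleGraph V} {a b : V} (h : G.Adj a b) : Nonsep G {a, b} := by
  refine ⟨⟨a, by simp⟩, ?_, ?_⟩
  · have hab : (del G ({a, b} : Set V)ᶜ).Reachable a b := Adj.reachable ⟨h, by simp, by simp⟩
    rintro x (rfl | rfl) y (rfl | rfl)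
    · exact Reachable.refl _
    · exact hab
    · exact hab.symm
    · exact Reachable.refl _
  · have hab : ∀ v, a ≠ v → b ≠ v → (del G (({a, b} : Set V)ᶜ ∪ {v})).Reachable a b :=
      fun v hav hbv => Adj.reachable ⟨h, by simpa using hav, by simpa using hbv⟩
    rintro v x (rfl | rfl) y (rfl | rfl) hx hy
    · exact Reachable.refl _
    · exact hab v hx hy
    · exact (hab v hy hx).symm
    · exact Reachable.refl _

theorem Nonsep.sUnion {G : SimpleGraph V} {c : Set (Set V)} (hc : IsChain (· ⊆ ·) c)
    (hne : c.Nonempty) (h : ∀ A ∈ c, Nonsep G A) : Nonsep G (⋃₀ c) := by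
  have hdir : ∀ a ∈ ⋃₀ c, ∀ b ∈ ⋃₀ c, ∃ A ∈ c, a ∈ A ∧ b ∈ A := by
    rintro a ⟨A, hA, ha⟩ b ⟨B, hB, hb⟩
    rcases hc.total hA hB with hAB | hAB
    · exact ⟨B, hB, hAB ha, hb⟩
    · exact ⟨A, hA, ha, hAB hb⟩
  refine ⟨?_, fun a ha b hb => ?_, fun v a ha b hb hav hbv => ?_⟩
  · obtain ⟨A, hA⟩ := hne
    exact (h A hA).nonempty.mono (Set.subset_sUnion_of_mem hA)
  · obtain ⟨A, hA, ha, hb⟩ := hdir a ha b hb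
    exact (h A hA).conn_of_subset (Set.subset_sUnion_of_mem hA) ha hb
  · obtain ⟨A, hA, ha, hb⟩ := hdir a ha b hb
    exact (h A hA).cut_of_subset (Set.subset_sUnion_of_mem hA) v ha hb hav hbv

theorem IsBlockSet.nonsep {G : SimpleGraph V} {B : Set V} (hB : IsBlockSet G B) : Nonsep G B :=
  nonseparable_induce_iff.1 hB.1

theorem IsBlockSet.eq_of_subset {G : SimpleGraph V} {A B : Set V} (hB : IsBlockSet G B)
    (hA : Nonsep G A) (h : B ⊆ A) : A = B :=
  hB.2 A h (nonseparable_induce_iff.2 hA)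

/-- Blocks sharing two vertices coincide. -/
theorem IsBlockSet.eq {G : SimpleGraph V} {A B : Set V} (hA : IsBlockSet G A)
    (hB : IsBlockSet G B) {x y : V} (hxy : x ≠ y) (hxA : x ∈ A) (hyA : y ∈ A) (hxB : x ∈ B)
    (hyB : y ∈ B) : A = B := by
  have h := hA.nonsep.union hB.nonsep hxy hxA hxB hyA hyB
  rw [← hA.eq_of_subset h Set.subset_union_left]
  exact hB.eq_of_subset h Set.subset_union_right

theorem exists_isBlockSet {G : SimpleGraph V} {a b : V} (h : G.Adj a b) :
    ∃ B, IsBlockSet G B ∧ a ∈ B ∧ b ∈ B := by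
  obtain ⟨B, hsub, hB⟩ := zorn_subset_nonempty {A | Nonsep G A}
    (fun c hc hchain hne => ⟨⋃₀ c, Nonsep.sUnion hchain hne fun A hA => hc hA,
      fun A hA => Set.subset_sUnion_of_mem hA⟩) {a, b} (nonsep_pair h)
  refine ⟨B, ⟨nonseparable_induce_iff.2 hB.prop, fun B' hBB' hB' => ?_⟩, hsub (by simp),
    hsub (by simp)⟩
  exact (hB.eq_of_subset (nonseparable_induce_iff.1 hB') hBB').symm

/-- A vertex of a path is connected to one of the ends avoiding another given vertex. -/
theorem reachable_end_of_isPath {H : SimpleGraph V} {a b : V} (p : H.Walk a b) (hp : p.IsPath)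
    {x z : V} (hx : x ∈ p.support) (hxz : x ≠ z) :
    (a ≠ z ∧ (del H ({y | y ∈ p.support}ᶜ ∪ {z})).Reachable a x) ∨
    (b ≠ z ∧ (del H ({y | y ∈ p.support}ᶜ ∪ {z})).Reachable b x) := by
  induction p with
  | nil =>
    simp only [Walk.support_nil, List.mem_singleton] at hx
    subst hx
    exact Or.inl ⟨hxz, Reachable.refl _⟩
  | @cons a c b hac p ih =>
    have hp' := (Walk.cons_isPath_iff hac p).1 hp
    have hmono : del H ({y | y ∈ p.support}ᶜ ∪ {z}) ≤
        del H ({y | y ∈ (Walk.cons hac p).support}ᶜ ∪ {z}) :=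
      del_anti (Set.union_subset_union_left _ (Set.compl_subset_compl.2 fun y hy => by
        simp only [Walk.support_cons, List.mem_cons, Set.mem_ofPred_eq] at hy ⊢
        exact Or.inr hy))
    rw [Walk.support_cons, List.mem_cons] at hx
    rcases hx with rfl | hx
    · exact Or.inl ⟨hxz, Reachable.refl _⟩
    · rcases ih hp'.1 hx with ⟨hcz, hr⟩ | ⟨hbz, hr⟩
      · by_cases haz : a = z
        · subst haz
          refine Or.inr ⟨fun hb => hp'.2 (hb ▸ p.end_mem_support), ?_⟩
          classical
          have := reachable_del_of_walk (S := {y | y ∈ p.support}ᶜ ∪ {a}) (p.dropUntil x hx)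
            (fun y hy => by
              have hy' := p.support_dropUntil_subset_support hx hy
              rintro (h | h)
              · exact h hy'
              · exact hp'.2 (h ▸ hy'))
          exact (this.mono hmono).symm
        · refine Or.inl ⟨haz, Reachable.trans (Adj.reachable ⟨hac, ?_, ?_⟩) (hr.mono hmono)⟩
          · simpa using haz
          · simpa using hcz
      · exact Or.inr ⟨hbz, hr.mono hmono⟩

/-- A neighbor of `v` outside a block containing `v` is separated from the block by `v`. -/
theorem IsBlockSet.not_reachable {G : SimpleGraph V} {B : Set V} (hB : IsBlockSet G B) {v y b : V}
    (hv : v ∈ B) (hy : y ∉ B) (hvy : G.Adj v y) (hb : b ∈ B) (hbv : b ≠ v) :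
    ¬ (del G {v}).Reachable b y := by
  rintro hr
  obtain ⟨p, hp⟩ := hr.exists_isPath
  set A : Set V := B ∪ {x | x ∈ p.support} with hA
  have hBA : B ⊆ A := Set.subset_union_left
  have hvp : v ∉ p.support := by
    intro h
    have hle : ∀ x ∈ p.support, x ∈ ({v}ᶜ : Set V) := by
      intro x hx
      refine mem_of_mem_support_del (H := G) (N := {v}ᶜ) (p.mapLe (by rw [compl_compl])) hbv ?_
      rwa [Walk.support_mapLe_eq_support]
    exact hle v h rfl
  have hyA : y ∈ A := Or.inr p.end_mem_support
  have hcut : ∀ z, ∃ c ∈ B, c ≠ z ∧ ∀ x ∈ A, x ≠ z → (del G (Aᶜ ∪ {z})).Reachable c x := by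
    intro z
    by_cases hzv : z = v
    · subst hzv
      refine ⟨b, hb, hbv, ?_⟩
      rintro x (hx | hx) hxz
      · exact hB.nonsep.cut_of_subset hBA z hb hx hbv hxz
      · classical
        refine (reachable_del_of_walk (S := Aᶜ ∪ {z}) (p.takeUntil x hx) fun w hw => ?_).mono
          (del_mono (del_le G _) _)
        have hw' := p.support_takeUntil_subset_support hx hw
        rintro (h | h)
        · exact h (Or.inr hw')
        · exact hvp (h ▸ hw')
    · have hvz : v ≠ z := fun h => hzv h.symm
      refine ⟨v, hv, hvz, ?_⟩
      rintro x (hx | hx) hxz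
      · exact hB.nonsep.cut_of_subset hBA z hv hx hvz hxz
      · have hmono : del (del G {v}) ({x | x ∈ p.support}ᶜ ∪ {z}) ≤ del G (Aᶜ ∪ {z}) :=
          (del_mono (del_le G _) _).trans (del_anti (Set.union_subset_union_left _
            (Set.compl_subset_compl.2 Set.subset_union_right)))
        rcases reachable_end_of_isPath p hp hx hxz with ⟨hbz, hr⟩ | ⟨hyz, hr⟩
        · exact (hB.nonsep.cut_of_subset hBA z hv hb hvz hbz).trans (hr.mono hmono)
        · refine Reachable.trans (Adj.reachable ⟨hvy, ?_, ?_⟩) (hr.mono hmono)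
          · rintro (h | h)
            · exact h (hBA hv)
            · exact hvz h
          · rintro (h | h)
            · exact h hyA
            · exact hyz h
  have hns : Nonsep G A := by
    have hcut' : ∀ z, ∀ a ∈ A, ∀ b ∈ A, a ≠ z → b ≠ z → (del G (Aᶜ ∪ {z})).Reachable a b := by
      intro z a ha b hb haz hbz
      obtain ⟨c, -, -, hc⟩ := hcut z
      exact (hc a ha haz).symm.trans (hc b hb hbz)
    have hroot : ∀ a ∈ A, (del G Aᶜ).Reachable v a := by
      rintro a (ha | ha)
      · exact hB.nonsep.conn_of_subset hBA hv ha
      · have hav : a ≠ v := fun h => hvp (h ▸ ha)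
        exact (hB.nonsep.conn_of_subset hBA hv hb).trans
          ((hcut' v b (hBA hb) a (Or.inr ha) hbv hav).mono (del_anti Set.subset_union_left))
    exact ⟨⟨v, hBA hv⟩, fun a ha b hb => (hroot a ha).symm.trans (hroot b hb), hcut'⟩
  exact hy (hB.eq_of_subset hns hBA ▸ hyA)

theorem reachable_del_of_dist_le {G : SimpleGraph V} (hconn : G.Connected) {r v x : V} (hxv : x ≠ v)
    (h : G.dist r x ≤ G.dist r v) : (del G {v}).Reachable r x := by
  classical
  obtain ⟨p, hp⟩ := (hconn.preconnected r x).exists_walk_length_eq_dist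
  refine reachable_del_of_walk p fun w hw hwv => ?_
  obtain rfl : w = v := hwv
  have h1 := p.length_takeUntil_lt_length hw hxv.symm
  have h2 := dist_le (p.takeUntil w hw)
  omega

theorem Nonsep.exists_adj {G : SimpleGraph V} {B : Set V} (hB : Nonsep G B) {v : V} (hv : v ∈ B)
    (h2 : B.Nontrivial) : ∃ x ∈ B, G.Adj v x := by
  obtain ⟨y, hy, hyv⟩ := h2.exists_ne v
  obtain ⟨p⟩ := hB.conn v hv y hy
  cases p with
  | nil => exact absurd rfl hyv
  | cons h _ => exact ⟨_, by simpa using h.2.2, h.1⟩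

/-! ### Rooted blocks and cells -/

section Cells

/-- The standing assumptions on `G`. -/
structure CactusLike (G : SimpleGraph V) : Prop where
  lf : LocFin G
  conn : G.Connected
  blocks : ∀ B : Set V, IsBlockSet G B →
    IsCycleSet G B ∨ ∃ a b : V, a ≠ b ∧ B = {a, b} ∧ G.Adj a b
  deg : ∀ v : V, (∀ C : G.Subgraph, IsCycleSub C → v ∉ C.verts) →
    {x | x ∈ G.neighborSet v ∧ (G.neighborSet x).ncard ≠ 1}.encard ≤ 2

/-- A block which is a cycle. -/
def CycBlock (G : SimpleGraph V) (B : Set V) : Prop := IsBlockSet G B ∧ IsCycleSet G B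

/-- The edge joining two adjacent vertices, as a vertex of the line graph. -/
def mkEdge {G : SimpleGraph V} {a b : V} (h : G.Adj a b) : G.edgeSet := ⟨s(a, b), h⟩

theorem exists_eq_mkEdge {G : SimpleGraph V} (e : G.edgeSet) :
    ∃ a b, ∃ h : G.Adj a b, e = mkEdge h := by
  obtain ⟨e, he⟩ := e
  induction e using Sym2.ind with
  | _ a b => exact ⟨a, b, he, rfl⟩

theorem exists_eq_mkEdge_of_mem {G : SimpleGraph V} {e : G.edgeSet} {a : V}
    (ha : a ∈ (e : Sym2 V)) : ∃ b, ∃ h : G.Adj a b, e = mkEdge h := by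
  obtain ⟨b, hb⟩ := ha
  have h : G.Adj a b := by
    have := e.2
    rwa [hb] at this
  exact ⟨b, h, Subtype.ext hb⟩

theorem mem_mkEdge {G : SimpleGraph V} {a b x : V} {h : G.Adj a b} :
    x ∈ (mkEdge h : Sym2 V) ↔ x = a ∨ x = b := Sym2.mem_iff

theorem mkEdge_comm {G : SimpleGraph V} {a b : V} (h : G.Adj a b) : mkEdge h = mkEdge h.symm :=
  Subtype.ext Sym2.eq_swap

/-- An edge is determined by two of its vertices. -/
theorem edge_ext {G : SimpleGraph V} {e f : G.edgeSet} {a b : V} (hab : a ≠ b)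
    (hae : a ∈ (e : Sym2 V)) (hbe : b ∈ (e : Sym2 V)) (haf : a ∈ (f : Sym2 V))
    (hbf : b ∈ (f : Sym2 V)) : e = f :=
  Subtype.ext (((Sym2.mem_and_mem_iff hab).1 ⟨hae, hbe⟩).trans
    ((Sym2.mem_and_mem_iff hab).1 ⟨haf, hbf⟩).symm)

theorem exists_block {G : SimpleGraph V} (e : G.edgeSet) :
    ∃ B, IsBlockSet G B ∧ ∀ x ∈ (e : Sym2 V), x ∈ B := by
  obtain ⟨a, b, h, rfl⟩ := exists_eq_mkEdge e
  obtain ⟨B, hB, ha, hb⟩ := exists_isBlockSet h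
  refine ⟨B, hB, fun x hx => ?_⟩
  rcases mem_mkEdge.1 hx with rfl | rfl
  · exact ha
  · exact hb

/-- The block containing an edge. -/
noncomputable def blk {G : SimpleGraph V} (e : G.edgeSet) : Set V := (exists_block e).choose

theorem isBlockSet_blk {G : SimpleGraph V} (e : G.edgeSet) : IsBlockSet G (blk e) :=
  (exists_block e).choose_spec.1

theorem mem_blk {G : SimpleGraph V} {e : G.edgeSet} {x : V} (hx : x ∈ (e : Sym2 V)) : x ∈ blk e :=
  (exists_block e).choose_spec.2 x hx

theorem blk_eq {G : SimpleGraph V} {e : G.edgeSet} {B : Set V} (hB : IsBlockSet G B) {a b : V}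
    (hab : a ≠ b) (ha : a ∈ (e : Sym2 V)) (hb : b ∈ (e : Sym2 V)) (haB : a ∈ B) (hbB : b ∈ B) :
    blk e = B :=
  (isBlockSet_blk e).eq hB hab (mem_blk ha) (mem_blk hb) haB hbB

theorem blk_nontrivial {G : SimpleGraph V} (e : G.edgeSet) : (blk e).Nontrivial := by
  obtain ⟨a, b, h, rfl⟩ := exists_eq_mkEdge e
  exact ⟨a, mem_blk (mem_mkEdge.2 (Or.inl rfl)), b, mem_blk (mem_mkEdge.2 (Or.inr rfl)), h.ne⟩

theorem CactusLike.nontrivial {G : SimpleGraph V} (hG : CactusLike G) {B : Set V}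
    (hB : IsBlockSet G B) : B.Nontrivial := by
  rcases hG.blocks B hB with h | ⟨a, b, hab, rfl, -⟩
  · obtain ⟨v, hv⟩ := h.2.1
    obtain ⟨x, y, hxy, hN⟩ := Set.ncard_eq_two.1 (h.2.2.2 v hv)
    have hx : x ∈ G.neighborSet v ∩ B := hN ▸ Or.inl rfl
    exact ⟨v, hv, x, hx.2, hx.1.ne⟩
  · exact ⟨a, by simp, b, by simp, hab⟩

/-- An edge whose block is not a cycle is the only edge of its block. -/
theorem CactusLike.mem_of_mem_blk {G : SimpleGraph V} (hG : CactusLike G) {e : G.edgeSet}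
    (he : ¬ CycBlock G (blk e)) {x : V} (hx : x ∈ blk e) : x ∈ (e : Sym2 V) := by
  rcases hG.blocks _ (isBlockSet_blk e) with h | ⟨a, b, hab, heq, -⟩
  · exact absurd ⟨isBlockSet_blk e, h⟩ he
  · obtain ⟨c, d, hcd, rfl⟩ := exists_eq_mkEdge e
    have hc : c ∈ blk (mkEdge hcd) := mem_blk (mem_mkEdge.2 (Or.inl rfl))
    have hd : d ∈ blk (mkEdge hcd) := mem_blk (mem_mkEdge.2 (Or.inr rfl))
    have := hcd.ne
    rw [mem_mkEdge]
    rw [heq] at hc hd hx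
    grind

theorem CactusLike.eq_of_blk_eq {G : SimpleGraph V} (hG : CactusLike G) {e f : G.edgeSet}
    (he : ¬ CycBlock G (blk e)) (h : blk f = blk e) : f = e := by
  obtain ⟨a, b, hab, rfl⟩ := exists_eq_mkEdge f
  have ha : a ∈ (mkEdge hab : Sym2 V) := mem_mkEdge.2 (Or.inl rfl)
  have hb : b ∈ (mkEdge hab : Sym2 V) := mem_mkEdge.2 (Or.inr rfl)
  exact edge_ext hab.ne ha hb (hG.mem_of_mem_blk he (h ▸ mem_blk ha))
    (hG.mem_of_mem_blk he (h ▸ mem_blk hb))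

theorem CycBlock.two_le {G : SimpleGraph V} (hlf : LocFin G) {B : Set V} (hB : CycBlock G B) {v : V}
    (hv : v ∈ B) : 2 ≤ (G.neighborSet v).ncard := by
  rw [← hB.2.2.2.2 v hv]
  exact Set.ncard_le_ncard Set.inter_subset_left (hlf v)

/-- A vertex in no cyclic block lies on no cycle. -/
theorem CactusLike.notMem_cycle {G : SimpleGraph V} (hG : CactusLike G) {v : V}
    (hv : ∀ B, CycBlock G B → v ∉ B) (C : G.Subgraph) (hC : IsCycleSub C) : v ∉ C.verts := by
  intro hvC
  obtain ⟨a, b, hab, hN⟩ := Set.ncard_eq_two.1 (hC.2.2.2 v hvC)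
  have ha : C.Adj v a := by
    change a ∈ C.neighborSet v
    rw [hN]; exact Or.inl rfl
  have hb : C.Adj v b := by
    change b ∈ C.neighborSet v
    rw [hN]; exact Or.inr rfl
  have hr : (del G {v}).Reachable a b :=
    (hC.isCyc.reachable_del (show C.spanningCoe.Adj v a from ha)
      (show C.spanningCoe.Adj v b from hb)).mono (del_mono C.spanningCoe_le _)
  set e := mkEdge ha.adj_sub with he
  have hve : v ∈ (e : Sym2 V) := mem_mkEdge.2 (Or.inl rfl)
  have hae : a ∈ (e : Sym2 V) := mem_mkEdge.2 (Or.inr rfl)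
  have hncb : ¬ CycBlock G (blk e) := fun h => hv _ h (mem_blk hve)
  refine (isBlockSet_blk e).not_reachable (mem_blk hve) (fun h => ?_) hb.adj_sub (mem_blk hae)
    ha.adj_sub.ne' hr
  rcases mem_mkEdge.1 (hG.mem_of_mem_blk hncb h) with h | h
  · exact hb.adj_sub.ne' h
  · exact hab h.symm

variable (G : SimpleGraph V) (r : V)

open Classical in
/-- A vertex of `B` closest to the root. -/
noncomputable def ent (B : Set V) : V :=
  if h : ∃ v ∈ B, ∀ b ∈ B, G.dist r v ≤ G.dist r b then h.choose else r

open Classical in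
/-- The cell of a vertex: a cyclic block through `v`, the one towards the root if possible, and
just `{v}` if there is none. -/
noncomputable def cell (v : V) : Set V :=
  if h : ∃ B, CycBlock G B ∧ v ∈ B ∧ ent G r B ≠ v then h.choose
  else if h : ∃ B, CycBlock G B ∧ v ∈ B then h.choose else {v}

variable {G r}

theorem ent_spec {B : Set V} (hB : B.Nonempty) :
    ent G r B ∈ B ∧ ∀ b ∈ B, G.dist r (ent G r B) ≤ G.dist r b := by
  have h : ∃ v ∈ B, ∀ b ∈ B, G.dist r v ≤ G.dist r b := by
    have hne : (G.dist r '' B).Nonempty := hB.image _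
    obtain ⟨v, hv, hv'⟩ := Nat.sInf_mem hne
    exact ⟨v, hv, fun b hb => hv' ▸ Nat.sInf_le ⟨b, hb, rfl⟩⟩
  rw [ent, dif_pos h]
  exact h.choose_spec

theorem ent_singleton (v : V) : ent G r {v} = v := (ent_spec (Set.singleton_nonempty v)).1

theorem exists_adj_dist_lt (hconn : G.Connected) {r a : V} (hra : r ≠ a) :
    ∃ y, G.Adj a y ∧ G.dist r y < G.dist r a := by
  obtain ⟨p, hp⟩ := (hconn.preconnected a r).exists_walk_length_eq_dist
  cases p with
  | nil => exact absurd rfl hra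
  | @cons _ y _ hay p =>
    have := dist_le p
    rw [Walk.length_cons, dist_comm] at hp
    rw [dist_comm] at this
    exact ⟨y, hay, by omega⟩

/-- The entry of a block is strictly closer to the root than all other vertices. -/
theorem dist_ent_lt (hconn : G.Connected) {B : Set V} (hB : IsBlockSet G B) {b : V} (hb : b ∈ B)
    (hne : ent G r B ≠ b) : G.dist r (ent G r B) < G.dist r b := by
  obtain ⟨hmem, hmin⟩ := ent_spec (G := G) (r := r) hB.nonsep.nonempty
  refine lt_of_le_of_ne (hmin b hb) fun heq => ?_
  set a := ent G r B with ha
  have hra : r ≠ a := by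
    intro h
    rw [← h, dist_self] at heq
    exact hne (h ▸ (hconn.dist_eq_zero_iff.1 heq.symm))
  obtain ⟨y, hay, h1⟩ := exists_adj_dist_lt hconn hra
  have hy : y ∉ B := fun h => absurd (hmin y h) (not_le.2 h1)
  exact hB.not_reachable hmem hy hay hb hne.symm
    ((reachable_del_of_dist_le hconn hne.symm heq.ge).symm.trans
      (reachable_del_of_dist_le hconn hay.ne' h1.le))

/-- At most one block at `v` leads towards the root. -/
theorem CactusLike.up_unique (hG : CactusLike G) {A B : Set V} (hA : IsBlockSet G A)
    (hB : IsBlockSet G B) {v : V} (hvA : v ∈ A) (hvB : v ∈ B) (hA' : ent G r A ≠ v)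
    (hB' : ent G r B ≠ v) : A = B := by
  by_contra hne
  obtain ⟨y, hy, hvy⟩ := hB.nonsep.exists_adj hvB (hG.nontrivial hB)
  have hyA : y ∉ A := fun h => hne (hA.eq hB hvy.ne hvA h hvB hy)
  obtain ⟨ha1, ha2⟩ := ent_spec (G := G) (r := r) hA.nonsep.nonempty
  obtain ⟨hb1, hb2⟩ := ent_spec (G := G) (r := r) hB.nonsep.nonempty
  refine hA.not_reachable hvA hyA hvy ha1 hA' ?_
  refine (reachable_del_of_dist_le hG.conn hA' (ha2 v hvA)).symm.trans
    ((reachable_del_of_dist_le hG.conn hB' (hb2 v hvB)).trans ?_)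
  exact (hB.nonsep.cut v _ hb1 y hy hB' hvy.ne').mono (del_anti Set.subset_union_right)

theorem cell_cases (v : V) : (CycBlock G (cell G r v) ∧ v ∈ cell G r v) ∨
    (cell G r v = {v} ∧ ∀ B, CycBlock G B → v ∉ B) := by
  unfold cell
  split_ifs with h1 h2
  · exact Or.inl ⟨h1.choose_spec.1, h1.choose_spec.2.1⟩
  · exact Or.inl h2.choose_spec
  · exact Or.inr ⟨rfl, fun B hB hv => h2 ⟨B, hB, hv⟩⟩

theorem mem_cell (v : V) : v ∈ cell G r v := by
  rcases cell_cases (G := G) (r := r) v with h | h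
  · exact h.2
  · rw [h.1]; rfl

theorem CactusLike.cell_eq (hG : CactusLike G) {B : Set V} (hB : CycBlock G B) {v : V} (hv : v ∈ B)
    (hne : ent G r B ≠ v) : cell G r v = B := by
  have h : ∃ B, CycBlock G B ∧ v ∈ B ∧ ent G r B ≠ v := ⟨B, hB, hv, hne⟩
  rw [cell, dif_pos h]
  exact hG.up_unique h.choose_spec.1.1 hB.1 h.choose_spec.2.1 hv h.choose_spec.2.2 hne

theorem CactusLike.ent_cell (hG : CactusLike G) {B : Set V} (hB : IsBlockSet G B) {v : V}
    (hv : v ∈ B) (hne : ent G r B ≠ v) (hcell : cell G r v ≠ B) : ent G r (cell G r v) = v := by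
  rcases cell_cases (G := G) (r := r) v with h | h
  · by_contra h'
    exact hcell (hG.up_unique h.1.1 hB h.2 hv h' hne)
  · rw [h.1, ent_singleton]

theorem finite_cell (v : V) : (cell G r v).Finite := by
  rcases cell_cases (G := G) (r := r) v with h | h
  · exact h.1.2.1
  · rw [h.1]; exact Set.finite_singleton v

/-- The ends of an edge whose block is not a cycle have disjoint cells. -/
theorem notMem_cell {a b : V} (h : G.Adj a b) (hncb : ¬ CycBlock G (blk (mkEdge h))) :
    a ∉ cell G r b := by
  intro ha
  rcases cell_cases (G := G) (r := r) b with h' | h'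
  · refine hncb ?_
    rw [blk_eq h'.1.1 h.ne (mem_mkEdge.2 (Or.inl rfl)) (mem_mkEdge.2 (Or.inr rfl)) ha h'.2]
    exact h'.1
  · rw [h'.1] at ha
    exact h.ne ha

end Cells

/-! ### The edges of a cell -/

section CellSystem

variable {G : SimpleGraph V} {r : V} {f : Set V → G.edgeSet}

/-- `f` chooses in every block an edge at the entry of the block. -/
def IsTop (r : V) (f : Set V → G.edgeSet) : Prop :=
  ∀ B, IsBlockSet G B → blk (f B) = B ∧ ent G r B ∈ (f B : Sym2 V)

theorem CactusLike.exists_isTop (hG : CactusLike G) [Nonempty G.edgeSet] :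
    ∃ f : Set V → G.edgeSet, IsTop r f := by
  have h : ∀ B, ∃ e : G.edgeSet, IsBlockSet G B → blk e = B ∧ ent G r B ∈ (e : Sym2 V) := by
    intro B
    by_cases hB : IsBlockSet G B
    · have hmem := (ent_spec (G := G) (r := r) hB.nonsep.nonempty).1
      obtain ⟨x, hx, hadj⟩ := hB.nonsep.exists_adj hmem (hG.nontrivial hB)
      exact ⟨mkEdge hadj, fun _ => ⟨blk_eq hB hadj.ne (mem_mkEdge.2 (Or.inl rfl))
        (mem_mkEdge.2 (Or.inr rfl)) hmem hx, mem_mkEdge.2 (Or.inl rfl)⟩⟩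
    · exact ⟨Classical.arbitrary _, fun h => absurd h hB⟩
  choose f hf using h
  exact ⟨f, hf⟩

variable (r f)

/-- The edges belonging to a cell: all edges of a cyclic block belong to the block, its top edge
belongs to the cell of the entry, and other edges belong to the cells of both ends. -/
def cellEdges (I : Set V) : Set G.edgeSet :=
  {e | (CycBlock G (blk e) ∧ (blk e = I ∨ (e = f (blk e) ∧ cell G r (ent G r (blk e)) = I))) ∨
    (¬ CycBlock G (blk e) ∧ ∃ v ∈ (e : Sym2 V), cell G r v = I)}

open Classical in
/-- The cell closest to the root among those an edge belongs to. -/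
noncomputable def homeCell (e : G.edgeSet) : Set V :=
  if e = f (blk e) then cell G r (ent G r (blk e)) else blk e

open Classical in
/-- The depth of a cell in the tree of cells. -/
noncomputable def cellDepth (G : SimpleGraph V) (r : V) (I : Set V) : ℕ :=
  2 * G.dist r (ent G r I) + if cell G r (ent G r I) = I then 0 else 1

open Classical in
/-- The number of blocks at `e` that may be used within the cell `I`. -/
noncomputable def cellWeight (I : Set V) (e : G.edgeSet) : ℕ :=
  if e ∉ cellEdges r f I then 0
  else if blk e = I then (if e = f I ∧ cell G r (ent G r I) ≠ I then 1 else 2)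
  else if ∃ v ∈ (e : Sym2 V), v ∈ I ∧ (G.neighborSet v).ncard = 1 then 0
  else if ∃ v ∈ (e : Sym2 V), (G.neighborSet v).ncard = 1 then 2 else 1

variable {r f}

theorem cellEdges_cases {I : Set V} {e : G.edgeSet} (h : e ∈ cellEdges r f I) :
    (CycBlock G I) ∨ ∃ v, cell G r v = I := by
  rcases h with ⟨h, rfl | h'⟩ | ⟨h, v, -, h'⟩
  · exact Or.inl h
  · exact Or.inr ⟨_, h'.2⟩
  · exact Or.inr ⟨_, h'⟩

theorem IsTop.eq_top (hf : IsTop r f) (hG : CactusLike G) {e : G.edgeSet}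
    (he : ¬ CycBlock G (blk e)) : e = f (blk e) :=
  (hG.eq_of_blk_eq he (hf _ (isBlockSet_blk e)).1).symm

theorem IsTop.home_ne (hf : IsTop r f) (hG : CactusLike G) {I : Set V} {e : G.edgeSet}
    (he : e ∈ cellEdges r f I) (hne : homeCell r f e ≠ I) :
    (CycBlock G I ∧ cell G r (ent G r I) ≠ I ∧ e = f I ∧ homeCell r f e = cell G r (ent G r I)) ∨
    (cell G r (ent G r I) = I ∧ ¬ CycBlock G (blk e) ∧ ent G r I ∈ (e : Sym2 V) ∧
      ent G r (blk e) ≠ ent G r I ∧ homeCell r f e = cell G r (ent G r (blk e))) := by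
  rcases he with ⟨hcb, rfl | ⟨h1, h2⟩⟩ | ⟨hcb, v, hv, rfl⟩
  · by_cases htop : e = f (blk e)
    · rw [homeCell, if_pos htop] at hne ⊢
      exact Or.inl ⟨hcb, hne, htop, rfl⟩
    · rw [homeCell, if_neg htop] at hne
      exact absurd rfl hne
  · rw [homeCell, if_pos h1] at hne
    exact absurd h2 hne
  · have htop := hf.eq_top hG hcb
    rw [homeCell, if_pos htop] at hne ⊢
    have hev : ent G r (blk e) ≠ v := fun h => hne (h ▸ rfl)
    have hent : ent G r (cell G r v) = v := by
      refine hG.ent_cell (isBlockSet_blk e) (mem_blk hv) hev fun h => ?_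
      rcases cell_cases (G := G) (r := r) v with h' | h'
      · exact hcb (h ▸ h'.1)
      · have h2 := blk_nontrivial e
        rw [← h, h'.1] at h2
        exact Set.not_nontrivial_singleton h2
    rw [hent]
    exact Or.inr ⟨rfl, hcb, hv, hev, rfl⟩

theorem CactusLike.cellDepth_cell_le (hG : CactusLike G) (v : V) :
    cellDepth G r (cell G r v) ≤ 2 * G.dist r v := by
  by_cases h : ent G r (cell G r v) = v
  · rw [cellDepth, if_pos (by rw [h]), h, add_zero]
  · rcases cell_cases (G := G) (r := r) v with h' | h'
    · have := dist_ent_lt hG.conn h'.1.1 h'.2 h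
      unfold cellDepth
      split_ifs <;> omega
    · rw [h'.1, ent_singleton] at h
      exact absurd rfl h

theorem IsTop.home_or (hf : IsTop r f) (hG : CactusLike G) (I : Set V) (e : G.edgeSet)
    (he : e ∈ cellEdges r f I) :
    homeCell r f e = I ∨ cellDepth G r (homeCell r f e) < cellDepth G r I := by
  by_cases hne : homeCell r f e = I
  · exact Or.inl hne
  refine Or.inr ?_
  rcases hf.home_ne hG he hne with ⟨-, h2, -, h4⟩ | ⟨h1, hcb, h2, h3, h4⟩
  · have := hG.cellDepth_cell_le (r := r) (ent G r I)
    rw [h4]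
    conv_rhs => rw [cellDepth, if_neg h2]
    omega
  · have h5 := hG.cellDepth_cell_le (r := r) (ent G r (blk e))
    have h6 := dist_ent_lt hG.conn (isBlockSet_blk e) (mem_blk h2) h3
    rw [h4]
    conv_rhs => rw [cellDepth, if_pos h1]
    omega

theorem IsTop.entry (hf : IsTop r f) (hG : CactusLike G) (I : Set V) (e e' : G.edgeSet)
    (he : e ∈ cellEdges r f I) (he' : e' ∈ cellEdges r f I) (hne : homeCell r f e ≠ I)
    (hne' : homeCell r f e' ≠ I) : e = e' := by
  rcases hf.home_ne hG he hne with ⟨-, h2, h3, -⟩ | ⟨h1, hcb, h2, h3, -⟩ <;>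
  rcases hf.home_ne hG he' hne' with ⟨-, h2', h3', -⟩ | ⟨h1', hcb', h2', h3', -⟩
  · rw [h3, h3']
  · exact absurd h1' h2
  · exact absurd h1 h2'
  · exact hG.eq_of_blk_eq hcb' (hG.up_unique (isBlockSet_blk e) (isBlockSet_blk e') (mem_blk h2)
      (mem_blk h2') h3 h3')

theorem CactusLike.two_cells (hG : CactusLike G) (e : G.edgeSet) :
    ∃ I J, (∀ K, e ∈ cellEdges r f K → K = I ∨ K = J) ∧
      cellWeight r f I e + cellWeight r f J e ≤ 2 := by
  by_cases hcb : CycBlock G (blk e)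
  · have hleaf : ∀ v ∈ (e : Sym2 V), (G.neighborSet v).ncard ≠ 1 := fun v hv h => by
      have := hcb.two_le hG.lf (mem_blk hv)
      omega
    have hw : ∀ J, J ≠ blk e → cellWeight r f J e ≤ 1 := by
      intro J hJ
      have h1 : ¬ ∃ v ∈ (e : Sym2 V), v ∈ J ∧ (G.neighborSet v).ncard = 1 :=
        fun ⟨v, hv, _, h⟩ => hleaf v hv h
      have h2 : ¬ ∃ v ∈ (e : Sym2 V), (G.neighborSet v).ncard = 1 :=
        fun ⟨v, hv, h⟩ => hleaf v hv h
      rw [cellWeight, if_neg (c := blk e = J) hJ.symm, if_neg h1, if_neg h2]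
      split_ifs <;> omega
    by_cases h : e = f (blk e) ∧ cell G r (ent G r (blk e)) ≠ blk e
    · refine ⟨blk e, cell G r (ent G r (blk e)), ?_, ?_⟩
      · rintro K (⟨-, h' | h'⟩ | ⟨h', -⟩)
        · exact Or.inl h'.symm
        · exact Or.inr h'.2.symm
        · exact absurd hcb h'
      · have h1 : cellWeight r f (blk e) e ≤ 1 := by
          rw [cellWeight, if_pos (c := blk e = blk e) rfl, if_pos h]
          split_ifs <;> omega
        have h2 := hw _ h.2
        omega
    · refine ⟨blk e, ∅, ?_, ?_⟩
      · rintro K (⟨-, h' | h'⟩ | ⟨h', -⟩)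
        · exact Or.inl h'.symm
        · by_cases h'' : cell G r (ent G r (blk e)) = blk e
          · exact Or.inl (h'.2.symm.trans h'')
          · exact absurd ⟨h'.1, h''⟩ h
        · exact absurd hcb h'
      · have h1 : cellWeight r f ∅ e = 0 := by
          refine if_pos fun h' => ?_
          rcases cellEdges_cases h' with h' | ⟨v, h'⟩
          · exact Set.not_nonempty_empty h'.2.2.1
          · have := mem_cell (G := G) (r := r) v
            rw [h'] at this
            exact this
        rw [h1, cellWeight, if_pos (c := blk e = blk e) rfl]
        split_ifs <;> omega
  · obtain ⟨u, v, huv, rfl⟩ := exists_eq_mkEdge e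
    refine ⟨cell G r u, cell G r v, ?_, ?_⟩
    · rintro K (⟨h', -⟩ | ⟨-, x, hx, rfl⟩)
      · exact absurd h' hcb
      · rcases mem_mkEdge.1 hx with rfl | rfl
        · exact Or.inl rfl
        · exact Or.inr rfl
    · have hblk : ∀ x, blk (mkEdge huv) ≠ cell G r x := by
        intro x hx
        rcases cell_cases (G := G) (r := r) x with h' | h'
        · exact hcb (hx ▸ h'.1)
        · have h2 := blk_nontrivial (mkEdge huv)
          rw [hx, h'.1] at h2
          exact Set.not_nontrivial_singleton h2
      have hmem : ∀ x ∈ (mkEdge huv : Sym2 V), mkEdge huv ∈ cellEdges r f (cell G r x) :=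
        fun x hx => Or.inr ⟨hcb, x, hx, rfl⟩
      have key : ∀ x ∈ (mkEdge huv : Sym2 V), cellWeight r f (cell G r x) (mkEdge huv) =
          if (G.neighborSet x).ncard = 1 then 0
          else if (G.neighborSet u).ncard = 1 ∨ (G.neighborSet v).ncard = 1 then 2 else 1 := by
        intro x hx
        rw [cellWeight, if_neg (not_not.2 (hmem x hx)), if_neg (hblk x)]
        have hx' := mem_mkEdge.1 hx
        have h1 : (∃ y ∈ (mkEdge huv : Sym2 V), y ∈ cell G r x ∧ (G.neighborSet y).ncard = 1) ↔
            (G.neighborSet x).ncard = 1 := by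
          refine ⟨?_, fun h => ⟨x, hx, mem_cell x, h⟩⟩
          rintro ⟨y, hy, hyx, h⟩
          have hvu : v ∉ cell G r u := notMem_cell huv.symm (by rwa [← mkEdge_comm huv])
          have huv' : u ∉ cell G r v := notMem_cell huv hcb
          have hy' := mem_mkEdge.1 hy
          grind
        have h2 : (∃ y ∈ (mkEdge huv : Sym2 V), (G.neighborSet y).ncard = 1) ↔
            ((G.neighborSet u).ncard = 1 ∨ (G.neighborSet v).ncard = 1) := by
          simp only [mem_mkEdge, exists_eq_or_imp, exists_eq_left]
        simp only [h1, h2]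
      rw [key u (mem_mkEdge.2 (Or.inl rfl)), key v (mem_mkEdge.2 (Or.inr rfl))]
      split_ifs <;> omega

end CellSystem

/-! ### The semi-cactus within a cell -/

section CellConstruction

variable {G : SimpleGraph V} {r : V} {f : Set V → G.edgeSet}

theorem lineGraph_adj_of_mem {e e' : G.edgeSet} (hne : e ≠ e') {x : V} (hx : x ∈ (e : Sym2 V))
    (hx' : x ∈ (e' : Sym2 V)) : G.lineGraph.Adj e e' :=
  ⟨hne, x, hx, hx'⟩

theorem exists_mem_of_lineGraph_adj {e e' : G.edgeSet} (h : G.lineGraph.Adj e e') :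
    e ≠ e' ∧ ∃ x, x ∈ (e : Sym2 V) ∧ x ∈ (e' : Sym2 V) := by
  obtain ⟨hne, x, hx, hx'⟩ := h
  exact ⟨hne, x, hx, hx'⟩

theorem LocFin.finite_edges (hlf : LocFin G) (v : V) :
    {e : G.edgeSet | v ∈ (e : Sym2 V)}.Finite := by
  refine Set.Finite.of_finite_image (f := Subtype.val)
    (((hlf v).image fun x => s(v, x)).subset ?_) Subtype.val_injective.injOn
  rintro _ ⟨e, he, rfl⟩
  obtain ⟨b, h, rfl⟩ := exists_eq_mkEdge_of_mem he
  exact ⟨b, h, rfl⟩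

theorem blk_mkEdge {I : Set V} (hI : IsBlockSet G I) {a b : V} (h : G.Adj a b) (ha : a ∈ I)
    (hb : b ∈ I) : blk (mkEdge h) = I :=
  blk_eq hI h.ne (mem_mkEdge.2 (Or.inl rfl)) (mem_mkEdge.2 (Or.inr rfl)) ha hb

/-- Every vertex of a cyclic block lies in exactly two edges of the block. -/
theorem CycBlock.exists_edges {I : Set V} (hI : CycBlock G I) {v : V} (hv : v ∈ I) :
    ∃ a b : G.edgeSet, a ≠ b ∧ v ∈ (a : Sym2 V) ∧ v ∈ (b : Sym2 V) ∧ blk a = I ∧ blk b = I ∧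
      ∀ e, blk e = I → v ∈ (e : Sym2 V) → e = a ∨ e = b := by
  obtain ⟨x, y, hxy, hN⟩ := Set.ncard_eq_two.1 (hI.2.2.2.2 v hv)
  have hx : x ∈ G.neighborSet v ∩ I := hN ▸ Or.inl rfl
  have hy : y ∈ G.neighborSet v ∩ I := hN ▸ Or.inr rfl
  have hvx : G.Adj v x := hx.1
  have hvy : G.Adj v y := hy.1
  refine ⟨mkEdge hvx, mkEdge hvy, fun h => ?_, mem_mkEdge.2 (Or.inl rfl), mem_mkEdge.2 (Or.inl rfl),
    blk_mkEdge hI.1 hvx hv hx.2, blk_mkEdge hI.1 hvy hv hy.2, fun e he hve => ?_⟩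
  · have : x ∈ (mkEdge hvy : Sym2 V) := h ▸ mem_mkEdge.2 (Or.inr rfl)
    rcases mem_mkEdge.1 this with h | h
    · exact hvx.ne' h
    · exact hxy h
  · obtain ⟨z, hvz, rfl⟩ := exists_eq_mkEdge_of_mem hve
    have hz : z ∈ G.neighborSet v ∩ I := ⟨hvz, he ▸ mem_blk (mem_mkEdge.2 (Or.inr rfl))⟩
    rw [hN] at hz
    rcases hz with rfl | rfl
    · exact Or.inl rfl
    · exact Or.inr rfl

theorem CycBlock.exists_other {I : Set V} (hI : CycBlock G I) {v : V} {e : G.edgeSet}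
    (he : blk e = I) (hv : v ∈ (e : Sym2 V)) : ∃ a : G.edgeSet, a ≠ e ∧ v ∈ (a : Sym2 V) ∧
      blk a = I ∧ ∀ e', blk e' = I → v ∈ (e' : Sym2 V) → e' = e ∨ e' = a := by
  obtain ⟨a, b, hab, ha, hb, ha', hb', h⟩ := hI.exists_edges (he ▸ mem_blk hv)
  rcases h e he hv with rfl | rfl
  · exact ⟨b, hab.symm, hb, hb', h⟩
  · exact ⟨a, hab, ha, ha', fun e' h1 h2 => (h e' h1 h2).symm⟩

/-- The line graph of the cycle induced by a cyclic block. -/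
def lineCycle (G : SimpleGraph V) (I : Set V) : SimpleGraph G.edgeSet where
  Adj e e' := G.lineGraph.Adj e e' ∧ blk e = I ∧ blk e' = I
  symm := ⟨fun _ _ h => ⟨h.1.symm, h.2.2, h.2.1⟩⟩
  loopless := ⟨fun _ h => h.1.ne rfl⟩

theorem CycBlock.support_lineCycle {I : Set V} (hI : CycBlock G I) :
    (lineCycle G I).support = {e | blk e = I} := by
  ext e
  constructor
  · intro h
    obtain ⟨e', h⟩ := h
    have h : (lineCycle G I).Adj e e' := h
    exact h.2.1
  · intro he
    obtain ⟨u, v, huv, rfl⟩ := exists_eq_mkEdge e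
    have hu : u ∈ (mkEdge huv : Sym2 V) := mem_mkEdge.2 (Or.inl rfl)
    obtain ⟨a, hne, hua, ha, -⟩ := hI.exists_other he hu
    exact ⟨a, lineGraph_adj_of_mem hne.symm hu hua, he, ha⟩

theorem CycBlock.isCyc_lineCycle {I : Set V} (hI : CycBlock G I) (hlf : LocFin G) :
    IsCyc (lineCycle G I) where
  finite := by
    rw [hI.support_lineCycle]
    refine (hI.2.1.biUnion fun v _ => hlf.finite_edges v).subset fun e he => ?_
    obtain ⟨u, v, huv, rfl⟩ := exists_eq_mkEdge e
    have hu : u ∈ (mkEdge huv : Sym2 V) := mem_mkEdge.2 (Or.inl rfl)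
    simp only [Set.mem_iUnion]
    exact ⟨u, (show blk (mkEdge huv) = I from he) ▸ mem_blk hu, hu⟩
  nonempty := by
    rw [hI.support_lineCycle]
    obtain ⟨v, hv⟩ := hI.2.2.1
    obtain ⟨a, -, -, -, -, ha, -⟩ := hI.exists_edges hv
    exact ⟨a, ha⟩
  conn e he e' he' := by
    rw [hI.support_lineCycle] at he he'
    obtain ⟨a, b, hab, rfl⟩ := exists_eq_mkEdge e
    obtain ⟨c, d, hcd, rfl⟩ := exists_eq_mkEdge e'
    have ha : a ∈ (mkEdge hab : Sym2 V) := mem_mkEdge.2 (Or.inl rfl)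
    have hc : c ∈ (mkEdge hcd : Sym2 V) := mem_mkEdge.2 (Or.inl rfl)
    have hshare : ∀ x, ∀ e e' : G.edgeSet, blk e = I → blk e' = I → x ∈ (e : Sym2 V) →
        x ∈ (e' : Sym2 V) → (lineCycle G I).Reachable e e' := by
      intro x e e' he he' hx hx'
      by_cases h : e = e'
      · exact h ▸ Reachable.refl _
      · exact Adj.reachable ⟨lineGraph_adj_of_mem h hx hx', he, he'⟩
    have key := reachable_induction (p := fun x => x ∈ I ∧ ∀ e', blk e' = I → x ∈ (e' : Sym2 V) →
        (lineCycle G I).Reachable (mkEdge hab) e')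
      (hI.1.nonsep.conn a (he ▸ mem_blk ha) c (he' ▸ mem_blk hc))
      ⟨he ▸ mem_blk ha, fun e' he' hx => hshare a _ _ he he' ha hx⟩ (by
        rintro x y ⟨hx, h⟩ hxy
        have hy : y ∈ I := by simpa using hxy.2.2
        have hblk := blk_mkEdge hI.1 hxy.1 hx hy
        exact ⟨hy, fun e' he' hye => (h _ hblk (mem_mkEdge.2 (Or.inl rfl))).trans
          (hshare y _ _ hblk he' (mem_mkEdge.2 (Or.inr rfl)) hye)⟩)
    exact key.2 _ he' hc
  deg e he := by
    rw [hI.support_lineCycle] at he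
    replace he : blk e = I := he
    obtain ⟨u, v, huv, rfl⟩ := exists_eq_mkEdge e
    have hu : u ∈ (mkEdge huv : Sym2 V) := mem_mkEdge.2 (Or.inl rfl)
    have hv : v ∈ (mkEdge huv : Sym2 V) := mem_mkEdge.2 (Or.inr rfl)
    obtain ⟨a, hane, hua, ha, ha'⟩ := hI.exists_other he hu
    obtain ⟨b, hbne, hvb, hb, hb'⟩ := hI.exists_other he hv
    rw [Set.ncard_eq_two]
    refine ⟨a, b, fun h => hane (edge_ext huv.ne hua (h ▸ hvb) hu hv), ?_⟩
    ext e'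
    constructor
    · rintro ⟨hadj, -, he'⟩
      obtain ⟨hne, x, hx, hx'⟩ := exists_mem_of_lineGraph_adj hadj
      rcases mem_mkEdge.1 hx with rfl | rfl
      · exact Or.inl ((ha' e' he' hx').resolve_left hne.symm)
      · exact Or.inr ((hb' e' he' hx').resolve_left hne.symm)
    · rintro (rfl | rfl)
      · exact ⟨lineGraph_adj_of_mem hane.symm hu hua, he, ha⟩
      · exact ⟨lineGraph_adj_of_mem hbne.symm hv hvb, he, hb⟩

/-- The line graph of a cycle can be extended to a cycle through further edges attached to it. -/
theorem CycBlock.exists_isCyc {I : Set V} (hI : CycBlock G I) (hlf : LocFin G)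
    (Y : Finset G.edgeSet) (hY : ∀ e ∈ Y, blk e ≠ I ∧ ∃ v ∈ I, v ∈ (e : Sym2 V)) :
    ∃ Z : SimpleGraph G.edgeSet, IsCyc Z ∧ Z ≤ G.lineGraph ∧ Z.support = {e | blk e = I} ∪ Y ∧
      ∀ v ∈ I, ∃ a b, Z.Adj a b ∧ v ∈ (a : Sym2 V) ∧ v ∈ (b : Sym2 V) := by
  classical
  induction Y using Finset.induction_on with
  | empty =>
    refine ⟨lineCycle G I, hI.isCyc_lineCycle hlf, fun _ _ h => h.1, by simp [hI.support_lineCycle],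
      fun v hv => ?_⟩
    obtain ⟨a, b, hab, hva, hvb, ha, hb, -⟩ := hI.exists_edges hv
    exact ⟨a, b, ⟨lineGraph_adj_of_mem hab hva hvb, ha, hb⟩, hva, hvb⟩
  | insert x Y hxY ih =>
    obtain ⟨Z, hZ, hle, hsupp, hpair⟩ := ih fun e he => hY e (Finset.mem_insert_of_mem he)
    obtain ⟨hxI, v, hv, hvx⟩ := hY x (Finset.mem_insert_self _ _)
    have hx : x ∉ Z.support := by
      rw [hsupp]
      rintro (h | h)
      · exact hxI h
      · exact hxY h
    obtain ⟨a, b, hab, hva, hvb⟩ := hpair v hv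
    have hxa : x ≠ a := fun h => hx (h ▸ hab.mem_support_left)
    have hxb : x ≠ b := fun h => hx (h ▸ hab.mem_support_right)
    refine ⟨IGraph.subdivide Z a b x, hZ.subdivide hab hx, fun p q hpq => ?_, ?_, fun u hu => ?_⟩
    · rw [subdivide_adj hxa hxb] at hpq
      rcases hpq with h | ⟨rfl, rfl | rfl⟩ | ⟨rfl, rfl | rfl⟩
      · exact hle h.1
      · exact lineGraph_adj_of_mem hxa hvx hva
      · exact lineGraph_adj_of_mem hxb hvx hvb
      · exact lineGraph_adj_of_mem hxa.symm hva hvx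
      · exact lineGraph_adj_of_mem hxb.symm hvb hvx
    · rw [support_subdivide hab hx, hsupp, Finset.coe_insert, Set.union_insert]
    · by_cases huv : u = v
      · subst huv
        exact ⟨x, a, (subdivide_adj hxa hxb _ _).2 (Or.inr (Or.inl ⟨rfl, Or.inl rfl⟩)), hvx, hva⟩
      · obtain ⟨c, d, hcd, huc, hud⟩ := hpair u hu
        refine ⟨c, d, (subdivide_adj hxa hxb _ _).2 (Or.inl ⟨hcd, ?_, ?_⟩), huc, hud⟩
        · rintro ⟨rfl, rfl⟩
          exact hab.ne (edge_ext huv huc hva hud hvb)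
        · rintro ⟨rfl, rfl⟩
          exact hab.ne (edge_ext huv hud hva huc hvb)

theorem CycBlock.one_le_cellWeight {I : Set V} (hI : CycBlock G I) (hlf : LocFin G) {e : G.edgeSet}
    (he : e ∈ cellEdges r f I) : 1 ≤ cellWeight r f I e := by
  have h1 : ¬ ∃ v ∈ (e : Sym2 V), v ∈ I ∧ (G.neighborSet v).ncard = 1 := by
    rintro ⟨v, -, hv, h⟩
    have := hI.two_le hlf hv
    omega
  rw [cellWeight, if_neg (not_not.2 he), if_neg h1]
  split_ifs <;> omega

theorem two_le_cellWeight {I : Set V} {e : G.edgeSet} (he : e ∈ cellEdges r f I) (hI : blk e = I)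
    (hne : e ≠ f I) : 2 ≤ cellWeight r f I e := by
  rw [cellWeight, if_neg (not_not.2 he), if_pos hI, if_neg fun h => hne h.1]

theorem IsTop.exists_mem (hf : IsTop r f) {I : Set V} {e : G.edgeSet} (he : e ∈ cellEdges r f I) :
    ∃ v ∈ I, v ∈ (e : Sym2 V) := by
  rcases he with ⟨-, rfl | ⟨h1, h2⟩⟩ | ⟨-, v, hv, h⟩
  · obtain ⟨u, v, huv, rfl⟩ := exists_eq_mkEdge e
    have hu : u ∈ (mkEdge huv : Sym2 V) := mem_mkEdge.2 (Or.inl rfl)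
    exact ⟨u, mem_blk hu, hu⟩
  · have h3 := (hf _ (isBlockSet_blk e)).2
    rw [← h1] at h3
    exact ⟨_, h2 ▸ mem_cell _, h3⟩
  · exact ⟨v, h ▸ mem_cell v, hv⟩

theorem finite_of_cellEdges {I : Set V} {e : G.edgeSet} (he : e ∈ cellEdges r f I) : I.Finite := by
  rcases cellEdges_cases he with h | ⟨v, rfl⟩
  · exact h.2.1
  · exact finite_cell v

theorem IsTop.finite_cellEdges (hf : IsTop r f) (hlf : LocFin G) (I : Set V) :
    (cellEdges r f I).Finite := by
  rcases (cellEdges r f I).eq_empty_or_nonempty with h | ⟨e, he⟩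
  · rw [h]; exact Set.finite_empty
  · refine ((finite_of_cellEdges he).biUnion fun v _ => hlf.finite_edges v).subset fun e he => ?_
    obtain ⟨v, hv, hve⟩ := hf.exists_mem he
    simp only [Set.mem_iUnion]
    exact ⟨v, hv, hve⟩

theorem IsTop.exists_cellSpec_cycBlock (hf : IsTop r f) (hlf : LocFin G) {I : Set V}
    (hI : CycBlock G I) :
    ∃ D Z, CellSpec G.lineGraph (cellEdges r f I) (cellWeight r f I) D Z := by
  classical
  have hEX : ∀ e : G.edgeSet, blk e = I → e ∈ cellEdges r f I := fun e he =>
    Or.inl ⟨he ▸ hI, Or.inl he⟩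
  have hw1 : ∀ e ∈ cellEdges r f I, 1 ≤ cellWeight r f I e :=
    fun e he => hI.one_le_cellWeight hlf he
  set Y : Finset G.edgeSet := (hf.finite_cellEdges hlf I).toFinset.filter
    fun e => blk e ≠ I with hYdef
  have hmemY : ∀ e, e ∈ Y ↔ e ∈ cellEdges r f I ∧ blk e ≠ I := by simp [hYdef]
  have hY : ∀ e ∈ Y, blk e ≠ I ∧ ∃ v ∈ I, v ∈ (e : Sym2 V) := fun e he =>
    ⟨((hmemY e).1 he).2, hf.exists_mem ((hmemY e).1 he).1⟩
  have hX : cellEdges r f I = {e | blk e = I} ∪ Y := by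
    ext e
    constructor
    · intro he
      by_cases h : blk e = I
      · exact Or.inl h
      · exact Or.inr ((hmemY e).2 ⟨he, h⟩)
    · rintro (h | h)
      · exact hEX e h
      · exact ((hmemY e).1 h).1
  by_cases heven : Even (cellEdges r f I).ncard
  · obtain ⟨Z, hZ, hle, hsupp, -⟩ := hI.exists_isCyc hlf Y hY
    rw [← hX] at hsupp
    rw [← hsupp] at heven hw1 ⊢
    exact ⟨Z, Z, CellSpec.of_cyc hZ hle heven hw1⟩
  rcases Y.eq_empty_or_nonempty with hYe | ⟨x, hx⟩
  · obtain ⟨Z, hZ, hle, hsupp, -⟩ := hI.exists_isCyc hlf ∅ (by simp)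
    have hfI : f I ∈ Z.support := by
      rw [hsupp]
      exact Or.inl (hf I hI.1).1
    obtain ⟨g, hg⟩ := hfI
    have hsuppX : Z.support = cellEdges r f I := by rw [hsupp, hX, hYe]
    have hfX : f I ∈ cellEdges r f I := hEX _ (hf I hI.1).1
    refine ⟨_, _, hsuppX ▸ CellSpec.of_cyc_deleteEdges hZ hle hg (hw1 _ hfX) fun e he hne => ?_⟩
    have he' : blk e = I := by
      rw [hsupp] at he
      simpa using he
    exact two_le_cellWeight (hEX e he') he' hne
  · obtain ⟨Z, hZ, hle, hsupp, -⟩ :=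
      hI.exists_isCyc hlf (Y.erase x) fun e he => hY e (Finset.mem_of_mem_erase he)
    obtain ⟨hxI, v, hv, hvx⟩ := hY x hx
    have hxZ : x ∉ Z.support := by
      rw [hsupp]
      rintro (h | h)
      · exact hxI h
      · simp at h
    have hsuppX : insert x Z.support = cellEdges r f I := by
      rw [hsupp, hX, ← Set.union_insert, ← Finset.coe_insert, Finset.insert_erase hx]
    have hevenZ : Even Z.support.ncard := by
      rw [← hsuppX, Set.ncard_insert_of_notMem hxZ hZ.finite] at heven
      by_contra h
      exact heven (Nat.not_even_iff_odd.1 h).add_one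
    obtain ⟨c, hvc, hc, hcf⟩ : ∃ c : G.edgeSet, v ∈ (c : Sym2 V) ∧ blk c = I ∧ c ≠ f I := by
      obtain ⟨a, b, hab, hva, hvb, ha, hb, -⟩ := hI.exists_edges hv
      by_cases h : a = f I
      · exact ⟨b, hvb, hb, fun h' => hab (h.trans h'.symm)⟩
      · exact ⟨a, hva, ha, h⟩
    have hcZ : c ∈ Z.support := by
      rw [hsupp]
      exact Or.inl hc
    refine ⟨_, _, hsuppX ▸ CellSpec.of_cyc_pendant hZ hle hevenZ hxZ hcZ
      (lineGraph_adj_of_mem (fun h => hxZ (h ▸ hcZ)) hvx hvc) (hsuppX ▸ hw1)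
      (two_le_cellWeight (hEX c hc) hc hcf)⟩

theorem CactusLike.exists_cellSpec_singleton (hG : CactusLike G) (hf : IsTop r f) {v : V}
    (hv : ∀ B, CycBlock G B → v ∉ B) :
    ∃ D Z, CellSpec G.lineGraph (cellEdges r f {v}) (cellWeight r f {v}) D Z := by
  have hmem : ∀ e ∈ cellEdges r f {v}, v ∈ (e : Sym2 V) := by
    intro e he
    obtain ⟨x, hx, hxe⟩ := hf.exists_mem he
    exact (show x = v from hx) ▸ hxe
  refine exists_cellSpec_of_clique (hf.finite_cellEdges hG.lf _)
    (fun a ha b hb hab => lineGraph_adj_of_mem hab (hmem a ha) (hmem b hb)) ?_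
  rintro ⟨a, ha, b, hb, hab⟩
  have hnl : (G.neighborSet v).ncard ≠ 1 := by
    intro h
    obtain ⟨x, hx, rfl⟩ := exists_eq_mkEdge_of_mem (hmem a ha)
    obtain ⟨y, hy, rfl⟩ := exists_eq_mkEdge_of_mem (hmem b hb)
    obtain ⟨z, hz⟩ := Set.ncard_eq_one.1 h
    have h1 : x = z := by
      have : x ∈ G.neighborSet v := hx
      rwa [hz] at this
    have h2 : y = z := by
      have : y ∈ G.neighborSet v := hy
      rwa [hz] at this
    subst h1
    subst h2
    exact hab rfl
  have h1 : ∀ e : G.edgeSet,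
      ¬ ∃ x ∈ (e : Sym2 V), x ∈ ({v} : Set V) ∧ (G.neighborSet x).ncard = 1 :=
    fun e ⟨x, _, hx, h⟩ => hnl ((show x = v from hx) ▸ h)
  have h2 : ∀ e : G.edgeSet, blk e ≠ {v} := fun e h => by
    have := blk_nontrivial e
    rw [h] at this
    exact Set.not_nontrivial_singleton this
  constructor
  · intro e he
    rw [cellWeight, if_neg (not_not.2 he), if_neg (h1 e), if_neg (h2 e)]
    split_ifs <;> omega
  · refine le_trans ?_ (hG.deg v (hG.notMem_cycle hv))
    rw [← Subtype.val_injective.injOn.encard_image]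
    refine le_trans (Set.encard_le_encard (t := (fun x => s(v, x)) '' {x | x ∈ G.neighborSet v ∧
      (G.neighborSet x).ncard ≠ 1}) ?_) (Set.encard_image_le _ _)
    rintro _ ⟨e, ⟨he, hwe⟩, rfl⟩
    obtain ⟨x, hx, rfl⟩ := exists_eq_mkEdge_of_mem (hmem e he)
    refine ⟨x, ⟨hx, fun h => ?_⟩, rfl⟩
    rw [cellWeight, if_neg (not_not.2 he), if_neg (h1 _), if_neg (h2 _),
      if_pos ⟨x, mem_mkEdge.2 (Or.inr rfl), h⟩] at hwe
    omega

theorem CactusLike.exists_cellSpec (hG : CactusLike G) (hf : IsTop r f) (I : Set V) :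
    ∃ D Z, CellSpec G.lineGraph (cellEdges r f I) (cellWeight r f I) D Z := by
  rcases (cellEdges r f I).eq_empty_or_nonempty with h | ⟨e, he⟩
  · rw [h]
    exact exists_cellSpec_of_clique Set.finite_empty (by simp) (by simp)
  · rcases cellEdges_cases he with h | ⟨v, rfl⟩
    · exact hf.exists_cellSpec_cycBlock hG.lf h
    · rcases cell_cases (G := G) (r := r) v with h | h
      · exact hf.exists_cellSpec_cycBlock hG.lf h.1
      · rw [h.1]
        exact hG.exists_cellSpec_singleton hf h.2

end CellConstruction

/-! ### Assembling the cells -/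

section Assembly

variable {G : SimpleGraph V} {r : V} {f : Set V → G.edgeSet}

/-- The edges in the cells through `x`. -/
def edgesAround (r : V) (f : Set V → G.edgeSet) (x : V) : Set G.edgeSet :=
  {e | ∃ I, x ∈ I ∧ e ∈ cellEdges r f I}

theorem mem_edgesAround {x : V} {e : G.edgeSet} (hx : x ∈ (e : Sym2 V)) :
    e ∈ edgesAround r f x := by
  by_cases h : CycBlock G (blk e)
  · exact ⟨blk e, mem_blk hx, Or.inl ⟨h, Or.inl rfl⟩⟩
  · exact ⟨cell G r x, mem_cell x, Or.inr ⟨h, x, hx, rfl⟩⟩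

theorem CactusLike.finite_edgesAround (hG : CactusLike G) (e : G.edgeSet) :
    {x | e ∈ edgesAround r f x}.Finite := by
  obtain ⟨I, J, hIJ, -⟩ := hG.two_cells (r := r) (f := f) e
  have hfin : {K | e ∈ cellEdges r f K}.Finite := (Set.toFinite {I, J}).subset hIJ
  refine (hfin.biUnion (t := id) fun K hK => finite_of_cellEdges hK).subset ?_
  rintro x ⟨K, hx, hK⟩
  exact Set.mem_biUnion hK hx

variable {D Z : Set V → SimpleGraph G.edgeSet}

theorem CactusLike.reachable_around (hG : CactusLike G) (hf : IsTop r f)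
    (hD : ∀ I, CellSpec G.lineGraph (cellEdges r f I) (cellWeight r f I) (D I) (Z I)) {x : V}
    {e e' : G.edgeSet} (he : x ∈ (e : Sym2 V)) (he' : x ∈ (e' : Sym2 V)) :
    (del (⨆ I, D I) (edgesAround r f x)ᶜ).Reachable e e' := by
  have hcell : ∀ I, x ∈ I → ∀ a ∈ cellEdges r f I, ∀ b ∈ cellEdges r f I,
      (del (⨆ I, D I) (edgesAround r f x)ᶜ).Reachable a b := by
    intro I hx a ha b hb
    refine ((hD I).conn a ha b hb).mono fun c d hcd => ⟨iSup_adj.2 ⟨I, hcd⟩, ?_, ?_⟩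
    · exact fun h => h ⟨I, hx, (hD I).mem c d hcd⟩
    · exact fun h => h ⟨I, hx, (hD I).mem d c hcd.symm⟩
  have hto : ∀ a : G.edgeSet, x ∈ (a : Sym2 V) → ∃ b ∈ cellEdges r f (cell G r x),
      (del (⨆ I, D I) (edgesAround r f x)ᶜ).Reachable a b := by
    intro a ha
    by_cases h : CycBlock G (blk a)
    · have hfa := (hf _ h.1).1
      have hmem : f (blk a) ∈ cellEdges r f (blk a) := Or.inl ⟨hfa.symm ▸ h, Or.inl hfa⟩
      refine ⟨f (blk a), ?_, hcell _ (mem_blk ha) a (Or.inl ⟨h, Or.inl rfl⟩) _ hmem⟩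
      by_cases hent : ent G r (blk a) = x
      · exact Or.inl ⟨hfa.symm ▸ h, Or.inr ⟨by rw [hfa], by rw [hfa, hent]⟩⟩
      · rwa [hG.cell_eq h (mem_blk ha) hent]
    · exact ⟨a, Or.inr ⟨h, x, ha, rfl⟩, Reachable.refl _⟩
  obtain ⟨b, hb, hab⟩ := hto e he
  obtain ⟨b', hb', hab'⟩ := hto e' he'
  exact hab.trans ((hcell _ (mem_cell x) b hb b' hb').trans hab'.symm)

theorem CactusLike.connected_iSup (hG : CactusLike G) [Nonempty G.edgeSet] (hf : IsTop r f)
    (hD : ∀ I, CellSpec G.lineGraph (cellEdges r f I) (cellWeight r f I) (D I) (Z I)) :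
    (⨆ I, D I).Connected := by
  have hshare : ∀ x, ∀ a b : G.edgeSet, x ∈ (a : Sym2 V) → x ∈ (b : Sym2 V) →
      (⨆ I, D I).Reachable a b :=
    fun x a b ha hb => (hG.reachable_around hf hD ha hb).mono (del_le _ _)
  refine ⟨fun e e' => ?_⟩
  obtain ⟨a, b, hab, rfl⟩ := exists_eq_mkEdge e
  obtain ⟨c, d, hcd, rfl⟩ := exists_eq_mkEdge e'
  refine reachable_induction (p := fun x => ∀ e' : G.edgeSet, x ∈ (e' : Sym2 V) →
    (⨆ I, D I).Reachable (mkEdge hab) e') (hG.conn.preconnected a c)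
    (fun e' h => hshare a _ _ (mem_mkEdge.2 (Or.inl rfl)) h) ?_ _ (mem_mkEdge.2 (Or.inl rfl))
  intro x y h hxy e' he'
  exact (h (mkEdge hxy) (mem_mkEdge.2 (Or.inl rfl))).trans
    (hshare y _ _ (mem_mkEdge.2 (Or.inr rfl)) he')

end Assembly

/-- If `G` is an infinite locally finite connected graph in which every
block is a cycle or a `K₂`, and every vertex not on a cycle has all but at most two of
its neighbors of degree 1, then `L(G)` has a faithful spanning even semi-cactus. -/
theorem lineGraph_semiCactus {V : Type u} (G : SimpleGraph V)
    (hinf : Infinite V) (hlf : LocFin G) (hconn : G.Connected)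
    (hblocks : ∀ B : Set V, IsBlockSet G B →
      IsCycleSet G B ∨ ∃ a b : V, a ≠ b ∧ B = {a, b} ∧ G.Adj a b)
    (hdeg : ∀ v : V, (∀ C : G.Subgraph, IsCycleSub C → v ∉ C.verts) →
      {x | x ∈ G.neighborSet v ∧ (G.neighborSet x).ncard ≠ 1}.encard ≤ 2) :
    ∃ D : SimpleGraph G.edgeSet, D ≤ G.lineGraph ∧ IsSemiCactus D ∧ EvenCycles D ∧
      Faithful D G.lineGraph := by
  have hG : CactusLike G := ⟨hlf, hconn, hblocks, hdeg⟩
  obtain ⟨r⟩ := hconn.nonempty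
  obtain ⟨s, hs⟩ := hconn.preconnected.exists_adj_of_nontrivial r
  have : Nonempty G.edgeSet := ⟨mkEdge hs⟩
  obtain ⟨f, hf⟩ := hG.exists_isTop (r := r)
  choose D Z hD using hG.exists_cellSpec hf
  have hT : CellTree G.lineGraph (cellEdges r f) (cellWeight r f) D Z (homeCell r f)
      (cellDepth G r) := ⟨hD, hf.home_or hG, hf.entry hG, hG.two_cells⟩
  refine ⟨⨆ I, D I, hT.le, hT.isSemiCactus (hG.connected_iSup hf hD), hT.evenCycles,
    faithful_of_local hT.le (fun x => {e | x ∈ (e : Sym2 V)}) (edgesAround r f)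
      hlf.finite_edges (fun e e' h => (exists_mem_of_lineGraph_adj h).2)
      (fun x e he e' he' => hG.reachable_around hf hD he he') hG.finite_edgesAround
      fun x e he => mem_edgesAround he⟩

end IGraph
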